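/- arXiv:1302.0380 — 2 statements merged into one kernel-verified Lean document; each statement's English description precedes it below -/
import Mathlib

section
/- For n ≥ k+1 ≥ 2 and m ≥ 1: if C_{#=n▷k} ≤_W XC_{m+1}, then C_{#=n▷(k+1)} ≤_W XC_m. -/
/-! Framework: represented spaces, realizers, (strong) topological Weihrauch reducibility. -/

/-- Baire space ℕ^ℕ (with the product topology). -/
abbrev Baire : Type := ℕ → ℕ

/-- A standard pairing ⟨p, q⟩ on Baire space (interleaving). -/
def pairB (p q : Baire) : Baire := fun n => if n % 2 = 0 then p (n / 2) else q (n / 2)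

/-- A representation of `X`: the name relation of a partial map from Baire space to `X`
(`R p x` means that `p` is a name of `x`). -/
structure RepSp (X : Type*) where
  R : Baire → X → Prop

/-- Restriction of a representation to names in `A` (used for restrictions `f_A`). -/
def RepSp.restrict {X : Type*} (δ : RepSp X) (A : Set Baire) : RepSp X :=
  ⟨fun p x => δ.R p x ∧ p ∈ A⟩

/-- `F` is a realizer of the multivalued function `f` (whose domain is
`{x | (f x).Nonempty}`) with respect to the given representations. -/
def Realizes {X Y : Type*} (δX : RepSp X) (δY : RepSp Y) (f : X → Set Y)
    (F : Baire → Baire) : Prop :=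
  ∀ p x, δX.R p x → (f x).Nonempty → ∃ y ∈ f x, δY.R (F p) y

/-- Topological Weihrauch reducibility `f ≤_W g`: there are continuous partial functions
`H` (pre-processor) and `K` (post-processor) on Baire space such that
`p ↦ K⟨p, G (H p)⟩` realizes `f` for every realizer `G` of `g`. -/
def WRed {X Y U V : Type*} (δX : RepSp X) (δY : RepSp Y) (δU : RepSp U) (δV : RepSp V)
    (f : X → Set Y) (g : U → Set V) : Prop :=
  ∃ (H K : Baire → Baire) (dH dK : Set Baire), ContinuousOn H dH ∧ ContinuousOn K dK ∧
    ∀ G : Baire → Baire, Realizes δU δV g G →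
      ∀ p x, δX.R p x → (f x).Nonempty →
        p ∈ dH ∧ pairB p (G (H p)) ∈ dK ∧
          ∃ y ∈ f x, δY.R (K (pairB p (G (H p)))) y

/-- Strong topological Weihrauch reducibility `f ≤_sW g`:
`K ∘ G ∘ H` realizes `f` for every realizer `G` of `g`. -/
def SWRed {X Y U V : Type*} (δX : RepSp X) (δY : RepSp Y) (δU : RepSp U) (δV : RepSp V)
    (f : X → Set Y) (g : U → Set V) : Prop :=
  ∃ (H K : Baire → Baire) (dH dK : Set Baire), ContinuousOn H dH ∧ ContinuousOn K dK ∧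
    ∀ G : Baire → Baire, Realizes δU δV g G →
      ∀ p x, δX.R p x → (f x).Nonempty →
        p ∈ dH ∧ G (H p) ∈ dK ∧ ∃ y ∈ f x, δY.R (K (G (H p))) y

/-! Negative representation of closed subsets of a separable metric space with a
fixed dense sequence, Cauchy representation of points, and choice principles. -/

/-- An enumeration of the nonnegative rationals (as reals): `n ↦ a/(b+1)` with `(a,b)` = unpair. -/
noncomputable def ratCode (n : ℕ) : ℝ := (n.unpair.1 : ℝ) / ((n.unpair.2 : ℝ) + 1)

/-- The rational open ball of `X` coded by `n` (center from the dense sequence `α`,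
rational radius; radius `0` yields the empty ball, allowing padding). -/
noncomputable def ballCode {X : Type*} [MetricSpace X] (α : ℕ → X) (n : ℕ) : Set X :=
  Metric.ball (α n.unpair.1) (ratCode n.unpair.2)

/-- The negative representation `ψ₋` of closed sets: a name `p` enumerates rational open
balls and denotes `X` minus their union. -/
noncomputable def psiMinus {X : Type*} [MetricSpace X] (α : ℕ → X) (p : Baire) : Set X :=
  {x | ∀ i, x ∉ ballCode α (p i)}

/-- The represented space `A(X)` of closed subsets of `X` (negative information). -/
noncomputable def closedRep {X : Type*} [MetricSpace X] (α : ℕ → X) : RepSp (Set X) :=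
  ⟨fun p A => A = psiMinus α p⟩

/-- The Cauchy representation of points of `X` (w.r.t. the dense sequence `α`). -/
noncomputable def pointRep {X : Type*} [MetricSpace X] (α : ℕ → X) : RepSp X :=
  ⟨fun p x => ∀ i, dist x (α (p i)) < (2:ℝ)⁻¹ ^ i⟩

/-- Closed choice restricted to a class `𝔄` of sets: the multivalued map `A ↦ A` with
domain the nonempty members of `𝔄`. -/
def choiceFn {X : Type*} (𝔄 : Set (Set X)) : Set X → Set X :=
  fun A => {x | A ∈ 𝔄 ∧ x ∈ A}

/-- The class of (finite) sets of cardinality exactly `n`. -/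
def cardEqClass (X : Type*) (n : ℕ) : Set (Set X) := {A | A.Finite ∧ A.ncard = n}

/-- The class of nonempty (finite) sets of cardinality at most `n`. -/
def cardLeClass (X : Type*) (n : ℕ) : Set (Set X) :=
  {A | A.Finite ∧ A.Nonempty ∧ A.ncard ≤ n}

/-- The unit cube `[0,1]^n` inside `ℝ^n`. -/
def unitCube (n : ℕ) : Set (Fin n → ℝ) := Set.univ.pi fun _ => Set.Icc (0:ℝ) 1

/-- The class of nonempty closed convex subsets of the unit cube `[0,1]^n`. -/
def convexClass (n : ℕ) : Set (Set (Fin n → ℝ)) :=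
  {A | A.Nonempty ∧ IsClosed A ∧ Convex ℝ A ∧ A ⊆ unitCube n}

/-! Discrete spaces, Cantor space, products, composition, fractals. -/

/-- Cantor space `{0,1}^ℕ`, with the standard (first-difference) metric, whose topology
is the product topology. -/
noncomputable instance : MetricSpace (ℕ → Bool) := PiNat.metricSpace

/-- Representation of closed subsets of the discrete space `Fin k`:
a name enumerates the complement (`0` codes "nothing", `m+1` codes `m`). -/
def finSetRep (k : ℕ) : RepSp (Set (Fin k)) :=
  ⟨fun p A => A = {m : Fin k | ∀ i, p i ≠ (m : ℕ) + 1}⟩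

/-- Representation of points of the discrete space `Fin k`: `p` names `m` iff `p 0 = m`. -/
def finPointRep (k : ℕ) : RepSp (Fin k) := ⟨fun p m => p 0 = (m : ℕ)⟩

/-- Representation of closed subsets of the discrete space `ℕ`:
a name enumerates the complement (`0` codes "nothing", `m+1` codes `m`). -/
def natSetRep : RepSp (Set ℕ) := ⟨fun p A => A = {m : ℕ | ∀ i, p i ≠ m + 1}⟩

/-- Representation of points of the discrete space `ℕ`: `p` names `m` iff `p 0 = m`. -/
def natPointRep : RepSp ℕ := ⟨fun p m => p 0 = m⟩

/-- The `i`-th component of a name of an `n`-tuple (interleaving `n` streams). -/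
def projB (n : ℕ) (i : Fin n) (p : Baire) : Baire := fun k => p (k * n + i)

/-- Representation of `n`-tuples: a name codes `n` names, interleaved. -/
def piRep {X : Type*} (n : ℕ) (δ : RepSp X) : RepSp (Fin n → X) :=
  ⟨fun p x => ∀ i, δ.R (projB n i p) (x i)⟩

/-- The `n`-fold parallel product `f^n` of a multivalued function. -/
def piFn {X Y : Type*} (n : ℕ) (f : X → Set Y) : (Fin n → X) → Set (Fin n → Y) :=
  fun x => {y | ∀ i, y i ∈ f (x i)}

/-- Composition `g ∘ h` of multivalued functions: defined on those `t ∈ dom h` with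
`h t ⊆ dom g`, mapping `t` to `⋃ {g u | u ∈ h t}`. -/
def mcomp {T U V : Type*} (g : U → Set V) (h : T → Set U) : T → Set V :=
  fun t => {v | (h t).Nonempty ∧ (∀ u ∈ h t, (g u).Nonempty) ∧ ∃ u ∈ h t, v ∈ g u}

/-- `f` is a fractal: there is a multivalued `g` on a represented space with nonempty
carrier such that for every clopen `A` of Baire space the restriction `g_A` of `g` to
inputs with names in `A` is Weihrauch equivalent to `f`, or to the nowhere defined
function `0` (i.e. `g_A` has empty domain). -/
def Fractal {X Y : Type*} (δX : RepSp X) (δY : RepSp Y) (f : X → Set Y) : Prop :=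
  ∃ (Z W : Type) (δZ : RepSp Z) (δW : RepSp W) (g : Z → Set W), Nonempty Z ∧
    ∀ A : Set Baire, IsClopen A →
      (WRed (δZ.restrict A) δW δX δY g f ∧ WRed δX δY (δZ.restrict A) δW f g)
      ∨ ¬ ∃ p z, δZ.R p z ∧ p ∈ A ∧ (g z).Nonempty

/-- `f` is a closed fractal: as `Fractal`, with the witnessing representation total. -/
def ClosedFractal {X Y : Type*} (δX : RepSp X) (δY : RepSp Y) (f : X → Set Y) : Prop :=
  ∃ (Z W : Type) (δZ : RepSp Z) (δW : RepSp W) (g : Z → Set W), Nonempty Z ∧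
    (∀ p : Baire, ∃ z, δZ.R p z) ∧
    ∀ A : Set Baire, IsClopen A →
      (WRed (δZ.restrict A) δW δX δY g f ∧ WRed δX δY (δZ.restrict A) δW f g)
      ∨ ¬ ∃ p z, δZ.R p z ∧ p ∈ A ∧ (g z).Nonempty

/-- `X_ε(𝔄)`: the closure (in Baire space) of the set of `ψ₋`-names of sets `A ∈ 𝔄` such
that for every `x ∈ X` some `B ∈ 𝔄` satisfies `B ⊆ A \ B(x, ε)`. -/
noncomputable def Xeps {X : Type*} [MetricSpace X] (α : ℕ → X) (𝔄 : Set (Set X))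
    (ε : ℝ) : Set Baire :=
  closure {p | psiMinus α p ∈ 𝔄 ∧
    ∀ x : X, ∃ B ∈ 𝔄, B ⊆ psiMinus α p \ Metric.ball x ε}

/-- The represented space `ℝ_>`: a name is a nonincreasing sequence of rationals
converging to `x` (approximation from above). -/
noncomputable def gtRep : RepSp ℝ :=
  ⟨fun p x => (∀ i, ((Denumerable.ofNat ℚ (p (i+1)) : ℚ) : ℝ) ≤ ((Denumerable.ofNat ℚ (p i) : ℚ) : ℝ)) ∧
    Filter.Tendsto (fun i => ((Denumerable.ofNat ℚ (p i) : ℚ) : ℝ)) Filter.atTop (nhds x)⟩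

/-- The class of closed subsets A of [0,1] with |A| = n that intersect at least k of the
n intervals [2i/(2n), (2i+1)/(2n)], i = 0,…,n−1 (domain of C_{#=n▷k}). -/
def boxClass (n k : ℕ) : Set (Set ↥(Set.Icc (0:ℝ) 1)) :=
  {A | A.Finite ∧ A.ncard = n ∧
    k ≤ {i : Fin n | ∃ x ∈ A,
      2 * (i : ℝ) / (2 * n) ≤ (x : ℝ) ∧ (x : ℝ) ≤ (2 * (i : ℝ) + 1) / (2 * n)}.ncard}

section BaireSpace

open Set Filter Topology Metric

theorem Baire.eventually_agree (p : Baire) (l : ℕ) : ∀ᶠ p' in 𝓝 p, ∀ i < l, p' i = p i := by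
  have := (PiNat.isOpen_cylinder (fun _ : ℕ => ℕ) p l).mem_nhds (PiNat.self_mem_cylinder p l)
  filter_upwards [this] with p' hp' i hi using hp' i hi

theorem Baire.exists_agree_of_mem_nhds {p : Baire} {N : Set Baire} (hN : N ∈ 𝓝 p) :
    ∃ l, ∀ p' : Baire, (∀ i < l, p' i = p i) → p' ∈ N := by
  obtain ⟨s, ⟨x, l, rfl⟩, hp, hs⟩ :=
    (PiNat.isTopologicalBasis_cylinders (fun _ : ℕ => ℕ)).mem_nhds_iff.1 hN
  exact ⟨l, fun p' h => hs fun i hi => (h i hi).trans (hp i hi)⟩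

theorem Baire.exists_agree_of_eventually {p : Baire} {D : Set Baire} {P : Baire → Prop}
    (h : ∀ᶠ p' in 𝓝[D] p, P p') :
    ∃ l, ∀ p' ∈ D, (∀ i < l, p' i = p i) → P p' := by
  obtain ⟨l, hl⟩ := Baire.exists_agree_of_mem_nhds (eventually_nhdsWithin_iff.1 h)
  exact ⟨l, fun r hD hr => hl r hr hD⟩

/-- Every subspace of Baire space is zero-dimensional: countable open covers have locally
constant selectors. -/
theorem Baire.exists_locally_constant_selector {D : Set Baire} {P : ℕ → Baire → Prop}
    (h : ∀ z ∈ D, ∃ c, ∀ᶠ z' in 𝓝[D] z, P c z') :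
    ∃ s : Baire → ℕ, ContinuousOn s D ∧ ∀ z ∈ D, P (s z) z := by
  classical
  let Q : ℕ → Baire → Prop := fun N z =>
    ∀ z' ∈ D, (∀ i < N.unpair.1, z' i = z i) → P N.unpair.2 z'
  have hQ : ∀ z ∈ D, ∃ N, Q N z := fun z hz => by
    obtain ⟨c, hc⟩ := h z hz
    obtain ⟨l, hl⟩ := Baire.exists_agree_of_eventually hc
    exact ⟨Nat.pair l c, by simpa [Q] using hl⟩
  have hQcongr : ∀ N z z', (∀ i < N.unpair.1, z' i = z i) → (Q N z ↔ Q N z') := by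
    intro N z z' hzz'
    constructor
    · exact fun H y hy hyz => H y hy fun i hi => (hyz i hi).trans (hzz' i hi)
    · exact fun H y hy hyz => H y hy fun i hi => (hyz i hi).trans (hzz' i hi).symm
  refine ⟨fun z => if hz : ∃ N, Q N z then (Nat.find hz).unpair.2 else 0, ?_, ?_⟩
  · intro z hz
    have hz' := hQ z hz
    refine continuousWithinAt_const.congr_of_eventuallyEq
      (f := fun _ => (Nat.find hz').unpair.2) ?_ (by simp [hz'])
    filter_upwards [nhdsWithin_le_nhds (Baire.eventually_agree z (Nat.find hz')),
      self_mem_nhdsWithin] with y hy hyD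
    have hle : ∀ N ≤ Nat.find hz', (Q N z ↔ Q N y) := fun N hN =>
      hQcongr N z y fun i hi => hy i (hi.trans_le ((Nat.unpair_left_le N).trans hN))
    have hyN := hQ y hyD
    have : Nat.find hyN = Nat.find hz' := by
      rw [Nat.find_eq_iff]
      exact ⟨(hle _ le_rfl).1 (Nat.find_spec hz'),
        fun N hN hNy => Nat.find_min hz' hN ((hle N hN.le).2 hNy)⟩
    simp only [hyN, dif_pos, this]
  · intro z hz
    have hz' := hQ z hz
    simp only [hz', dif_pos]
    exact Nat.find_spec hz' z hz fun _ _ => rfl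

end BaireSpace

section Names

open Set Filter Topology Metric

variable {X : Type*} [MetricSpace X]

theorem exists_ratCode_between {a b : ℝ} (ha : 0 ≤ a) (hab : a < b) :
    ∃ n, a < ratCode n ∧ ratCode n < b := by
  obtain ⟨q, haq, hqb⟩ := exists_rat_btwn hab
  have hq : 0 ≤ q := by exact_mod_cast ha.trans haq.le
  have : ratCode (Nat.pair q.num.toNat (q.den - 1)) = q := by
    have hden : ((q.den - 1 : ℕ) : ℝ) + 1 = q.den := by
      exact_mod_cast Nat.sub_add_cancel q.pos
    have hnum : ((q.num.toNat : ℕ) : ℝ) = (q.num : ℝ) := by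
      exact_mod_cast Int.toNat_of_nonneg (Rat.num_nonneg.2 hq)
    rw [ratCode, Nat.unpair_pair, hden, hnum]
    exact_mod_cast Rat.num_div_den q
  exact ⟨_, this ▸ haq, this ▸ hqb⟩

theorem ballCode_zero (α : ℕ → X) : ballCode α 0 = ∅ := by
  simp [ballCode, ratCode, Nat.unpair_zero]

theorem exists_mem_ballCode {α : ℕ → X} (hα : DenseRange α) (x : X) {ε : ℝ} (hε : 0 < ε) :
    ∃ c, x ∈ ballCode α c ∧ closure (ballCode α c) ⊆ ball x ε := by
  obtain ⟨i, hi⟩ := hα.exists_dist_lt x (ε := ε / 4) (by positivity)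
  obtain ⟨r, hr1, hr2⟩ := exists_ratCode_between (a := ε / 4) (b := ε / 2) (by positivity)
    (by linarith)
  refine ⟨Nat.pair i r, ?_, ?_⟩
  · simpa [ballCode] using hi.trans hr1
  · intro y hy
    have hy' := closure_ball_subset_closedBall hy
    simp only [Nat.unpair_pair, mem_closedBall] at hy'
    have := dist_triangle y (α i) x
    rw [dist_comm (α i) x] at this
    rw [mem_ball]
    linarith

theorem isClosed_psiMinus (α : ℕ → X) (p : Baire) : IsClosed (psiMinus α p) := by
  have : psiMinus α p = (⋃ i, ballCode α (p i))ᶜ := by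
    ext x; simp [psiMinus]
  rw [this]
  exact (isOpen_iUnion fun _ => isOpen_ball).isClosed_compl

/-- Negative information about a compact part of a closed set is finitary. -/
theorem eventually_inter_psiMinus_subset (α : ℕ → X) {S O : Set X} (hS : IsCompact S)
    (hO : IsOpen O) {p : Baire} (h : S ∩ psiMinus α p ⊆ O) :
    ∀ᶠ p' in 𝓝 p, S ∩ psiMinus α p' ⊆ O := by
  obtain ⟨t, ht⟩ := (hS.diff hO).elim_finite_subcover (fun i => ballCode α (p i))
    (fun _ => isOpen_ball) (fun x hx => by
      by_contra hx'
      exact hx.2 (h ⟨hx.1, fun i hi => hx' (mem_iUnion.2 ⟨i, hi⟩)⟩))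
  filter_upwards [Baire.eventually_agree p (t.sup id + 1)] with p' hp' x hx
  by_contra hxO
  obtain ⟨i, hi, hxi⟩ := mem_iUnion₂.1 (ht ⟨hx.1, hxO⟩)
  refine hx.2 i ?_
  rwa [hp' i (Nat.lt_succ_of_le (Finset.le_sup (f := id) hi))]

/-- Upper semicontinuous closed-set-valued maps on subspaces of Baire space lift to names. -/
theorem exists_continuous_closed_name {β : ℕ → X} (hβ : DenseRange β) {D : Set Baire}
    {C : Baire → Set X} (h : ∀ p ∈ D, ∀ x ∉ C p, ∃ ε > 0,
      ∀ᶠ p' in 𝓝[D] p, Disjoint (ball x ε) (C p')) :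
    ∃ H : Baire → Baire, Continuous H ∧ ∀ p ∈ D, psiMinus β (H p) = C p := by
  classical
  refine ⟨fun p j => if ∀ p' ∈ D, (∀ i < j.unpair.1, p' i = p i) →
    Disjoint (ballCode β j.unpair.2) (C p') then j.unpair.2 else 0, ?_, ?_⟩
  · refine continuous_pi fun j => continuous_iff_continuousAt.2 fun p => ?_
    refine continuousAt_const.congr (f := fun _ => if ∀ p' ∈ D, (∀ i < j.unpair.1, p' i = p i) →
      Disjoint (ballCode β j.unpair.2) (C p') then j.unpair.2 else 0) ?_
    filter_upwards [Baire.eventually_agree p j.unpair.1] with q hq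
    have : ∀ p' : Baire, (∀ i < j.unpair.1, p' i = q i) ↔ (∀ i < j.unpair.1, p' i = p i) :=
      fun p' => forall₂_congr fun i hi => by rw [hq i hi]
    simp only [this]
  · intro p hp
    ext x
    change (∀ j, _) ↔ _
    beta_reduce
    constructor
    · intro hx
      by_contra hxC
      obtain ⟨ε, hε, hev⟩ := h p hp x hxC
      obtain ⟨l, hl⟩ := Baire.exists_agree_of_eventually hev
      obtain ⟨c, hxc, hc⟩ := exists_mem_ballCode hβ x hε
      refine hx (Nat.pair l c) ?_
      rw [if_pos]
      · simpa using hxc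
      · simp only [Nat.unpair_pair]
        exact fun p' hp' hagree => (hl p' hp' hagree).mono_left (subset_closure.trans hc)
    · intro hxC j
      split_ifs with hj
      · exact fun hxj => disjoint_left.1 (hj p hp fun _ _ => rfl) hxj hxC
      · simp [ballCode_zero]

theorem pointRep_exists {α : ℕ → X} (hα : DenseRange α) (x : X) : ∃ q, (pointRep α).R q x := by
  choose q hq using fun i : ℕ => hα.exists_dist_lt x (ε := (2 : ℝ)⁻¹ ^ i) (by positivity)
  exact ⟨q, hq⟩

theorem pointRep_unique {α : ℕ → X} {q : Baire} {x y : X} (hx : (pointRep α).R q x)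
    (hy : (pointRep α).R q y) : x = y := by
  refine eq_of_forall_dist_le fun ε hε => ?_
  obtain ⟨i, hi⟩ := exists_pow_lt_of_lt_one (half_pos hε) (y := (2 : ℝ)⁻¹) (by norm_num)
  have := dist_triangle_right x y (α (q i))
  have h1 := hx i
  have h2 := hy i
  linarith

/-- Every point close to `x` has a name sharing a given prefix with a given name of `x`. -/
theorem pointRep_eventually_exists_agree {α : ℕ → X} (hα : DenseRange α) {q : Baire} {x : X}
    (hx : (pointRep α).R q x) (l : ℕ) :
    ∀ᶠ x' in 𝓝 x, ∃ q', (pointRep α).R q' x' ∧ ∀ i < l, q' i = q i := by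
  have : ∀ᶠ x' in 𝓝 x, ∀ i ∈ Finset.range l, dist x' (α (q i)) < (2 : ℝ)⁻¹ ^ i :=
    (eventually_all_finset _).2 fun i _ =>
      (continuous_id.dist continuous_const).continuousAt.eventually_lt continuousAt_const (hx i)
  filter_upwards [this] with x' hx'
  obtain ⟨q₀, hq₀⟩ := pointRep_exists hα x'
  refine ⟨fun i => if i < l then q i else q₀ i, fun i => ?_, fun i hi => by simp [hi]⟩
  by_cases hi : i < l
  · simpa [hi] using hx' i (Finset.mem_range.2 hi)
  · simpa [hi] using hq₀ i

/-- A zero-dimensional selection theorem: lower semicontinuous maps with nonempty closed values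
have selectors that are continuous on the level of names. -/
theorem exists_continuous_point_name [CompleteSpace X] {α : ℕ → X} (hα : DenseRange α)
    {D : Set Baire} {S : Baire → Set X} (hne : ∀ z ∈ D, (S z).Nonempty)
    (hcl : ∀ z ∈ D, IsClosed (S z))
    (hlsc : ∀ z ∈ D, ∀ a ∈ S z, ∀ r > 0, ∀ᶠ z' in 𝓝[D] z, (S z' ∩ ball a r).Nonempty) :
    ∃ K : Baire → Baire, ContinuousOn K D ∧ ∀ z ∈ D, ∃ y ∈ S z, (pointRep α).R (K z) y := by
  let r : ℕ → ℝ := fun i => (1 / 8) / 2 ^ i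
  have hr : ∀ i, 0 < r i := fun i => by positivity
  let T : ℕ → Type := fun i =>
    {s : Baire → ℕ // ContinuousOn s D ∧ ∀ z ∈ D, ∃ a ∈ S z, dist a (α (s z)) < r i}
  have near : ∀ (z : Baire) (a : X) (c : ℕ) (ρ : ℝ), z ∈ D → a ∈ S z → dist a (α c) < ρ →
      ∀ᶠ z' in 𝓝[D] z, ∃ a' ∈ S z', dist a' (α c) < ρ := by
    intro z a c ρ hz ha hac
    filter_upwards [hlsc z hz a ha (ρ - dist a (α c)) (by linarith)] with z' ⟨b, hb, hba⟩
    refine ⟨b, hb, ?_⟩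
    have := dist_triangle b a (α c)
    rw [mem_ball] at hba
    linarith
  have start : Nonempty (T 0) := by
    obtain ⟨s, hs, hs'⟩ := Baire.exists_locally_constant_selector (D := D)
      (P := fun c z => ∃ a ∈ S z, dist a (α c) < r 0) (fun z hz => by
        obtain ⟨a, ha⟩ := hne z hz
        obtain ⟨c, hc⟩ := hα.exists_dist_lt a (hr 0)
        exact ⟨c, near z a c _ hz ha hc⟩)
    exact ⟨⟨s, hs, hs'⟩⟩
  have step : ∀ i (s : T i), ∃ s' : T (i + 1), ∀ z ∈ D,
      dist (α (s.1 z)) (α (s'.1 z)) < r i + r (i + 1) := by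
    rintro i ⟨s, hs, hsd⟩
    obtain ⟨s', hs', hsd'⟩ := Baire.exists_locally_constant_selector (D := D)
      (P := fun c z => (∃ a ∈ S z, dist a (α c) < r (i + 1)) ∧
        dist (α (s z)) (α c) < r i + r (i + 1)) (fun z hz => by
        obtain ⟨a, ha, has⟩ := hsd z hz
        obtain ⟨c, hc⟩ := hα.exists_dist_lt a (hr (i + 1))
        refine ⟨c, (near z a c _ hz ha hc).and ?_⟩
        have hsz : ∀ᶠ z' in 𝓝[D] z, s z' = s z :=
          (hs z hz).eventually ((isOpen_discrete {s z}).mem_nhds rfl)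
        filter_upwards [hsz] with z' hz'
        rw [hz']
        have := dist_triangle_left (α (s z)) (α c) a
        linarith)
    exact ⟨⟨s', hs', fun z hz => (hsd' z hz).1⟩, fun z hz => (hsd' z hz).2⟩
  choose next hnext using step
  let f : ∀ i, T i := fun i => Nat.rec start.some (fun i s => next i s) i
  have hf : ∀ i, ∀ z ∈ D, dist (α ((f i).1 z)) (α ((f (i + 1)).1 z)) < r i + r (i + 1) :=
    fun i => hnext i (f i)
  refine ⟨fun z i => (f i).1 z, continuousOn_pi.2 fun i => (f i).2.1, fun z hz => ?_⟩
  have hgeo : ∀ i, dist (α ((f i).1 z)) (α ((f (i + 1)).1 z)) ≤ 3 / 8 / 2 / 2 ^ i := fun i => by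
    refine (hf i z hz).le.trans (le_of_eq ?_)
    simp only [r, pow_succ]
    field_simp
    norm_num
  obtain ⟨y, hy⟩ := cauchySeq_tendsto_of_complete (cauchySeq_of_le_geometric_two hgeo)
  have hdist := dist_le_of_le_geometric_two_of_tendsto hgeo hy
  choose a haS ha using fun i => (f i).2.2 z hz
  refine ⟨y, ?_, fun i => ?_⟩
  · refine (hcl z hz).mem_of_tendsto (f := a) (b := atTop) ?_ (Eventually.of_forall haS)
    have h0 : Tendsto r atTop (𝓝 0) := by
      have := (tendsto_pow_atTop_nhds_zero_of_lt_one (r := (1 / 2 : ℝ)) (by norm_num)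
        (by norm_num)).const_mul (1 / 8)
      simpa [r, div_eq_mul_inv] using this
    refine (tendsto_iff_of_dist ?_).2 hy
    exact squeeze_zero (fun _ => dist_nonneg) (fun i => (ha i).le) h0
  · rw [dist_comm]
    refine (hdist i).trans_lt ?_
    rw [inv_pow, div_eq_mul_inv]
    have : (0 : ℝ) < (2 ^ i)⁻¹ := by positivity
    linarith

end Names

section SimplexValued

open Set Filter Topology Metric

theorem pointRep_eventually_dist_lt {X : Type*} [MetricSpace X] {α : ℕ → X} {q : Baire} {x : X}
    (hx : (pointRep α).R q x) {ε : ℝ} (hε : 0 < ε) :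
    ∀ᶠ q' in 𝓝 q, ∀ x', (pointRep α).R q' x' → dist x' x < ε := by
  obtain ⟨l, hl⟩ := exists_pow_lt_of_lt_one (half_pos hε) (y := (2 : ℝ)⁻¹) (by norm_num)
  filter_upwards [Baire.eventually_agree q (l + 1)] with q' hq' x' hx'
  have h1 := hx' l
  have h2 := hx l
  rw [hq' l (Nat.lt_succ_self l)] at h1
  have := dist_triangle_right x' x (α (q l))
  linarith

theorem mem_convexHull_sdiff {E : Type*} [AddCommGroup E] [Module ℝ E] {s : Set E}
    (hs : AffineIndependent ℝ ((↑) : s → E)) (hfin : s.Finite) {x : E}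
    (hx : x ∈ convexHull ℝ s) {T : Set E} (h : ∀ a ∈ s ∩ T, x ∈ convexHull ℝ (s \ {a})) :
    x ∈ convexHull ℝ (s \ T) := by
  classical
  lift s to Finset E using hfin
  have key : ∀ t : Finset E, (∀ a ∈ t, a ∈ (s : Set E) ∩ T) →
      x ∈ convexHull ℝ ((s \ t : Finset E) : Set E) := by
    intro t
    induction t using Finset.induction_on with
    | empty => exact fun _ => by simpa using hx
    | insert a t _ ih =>
      intro ht
      have h1 := ih fun b hb => ht b (Finset.mem_insert_of_mem hb)
      have h2 : x ∈ convexHull ℝ ((s \ {a} : Finset E) : Set E) := by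
        simpa using h a (ht a (Finset.mem_insert_self a t))
      have h3 := (AffineIndependent.convexHull_inter hs (Finset.sdiff_subset (s := s) (t := {a}))
        (Finset.sdiff_subset (s := s) (t := t))).ge ⟨h2, h1⟩
      refine convexHull_mono ?_ h3
      intro y
      simp
      tauto
  have := key (s.filter (· ∈ T)) (by simp)
  refine convexHull_mono ?_ this
  intro y
  simp
  tauto

variable {X E : Type*} [MetricSpace X] [NormedAddCommGroup E] [NormedSpace ℝ E]

theorem eventually_notMem_convexHull_image {γ : X → E} (hγ : Continuous γ) {D : Set Baire}
    {A : Baire → Set X} {p : Baire} (hfin : (A p).Finite)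
    (husc : ∀ O, IsOpen O → A p ⊆ O → ∀ᶠ p' in 𝓝[D] p, A p' ⊆ O) {U : Set X} (hU : IsOpen U)
    {x : E} (hx : x ∉ convexHull ℝ (γ '' (A p \ U))) :
    ∃ ε > 0, ∀ᶠ p' in 𝓝[D] p, ∀ x' ∈ ball x ε, x' ∉ convexHull ℝ (γ '' (A p' \ U)) := by
  have hcomp : IsCompact (convexHull ℝ (γ '' (A p \ U))) :=
    ((hfin.subset sdiff_subset).image γ).isCompact_convexHull ℝ
  obtain ⟨ε, hε, hdisj⟩ := (disjoint_singleton_left.2 hx).exists_thickenings isCompact_singleton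
    hcomp.isClosed
  refine ⟨ε, hε, ?_⟩
  have hO : IsOpen (γ ⁻¹' thickening ε (convexHull ℝ (γ '' (A p \ U))) ∪ U) :=
    (isOpen_thickening.preimage hγ).union hU
  filter_upwards [husc _ hO fun a ha => by
    by_cases haU : a ∈ U
    · exact Or.inr haU
    · exact Or.inl (self_subset_thickening hε _ (subset_convexHull ℝ _ ⟨a, ⟨ha, haU⟩, rfl⟩))]
    with p' hp' x' hx' hmem
  rw [thickening_singleton] at hdisj
  refine disjoint_left.1 hdisj hx' ?_
  refine convexHull_min ?_ ((convex_convexHull ℝ _).thickening ε) hmem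
  rintro _ ⟨a, ⟨ha, haU⟩, rfl⟩
  exact (hp' ha).resolve_right haU

/-- An upper semicontinuous finite-set-valued map whose values are mapped by `γ` to vertex sets of
simplices can be solved by choosing points in these simplices. -/
theorem exists_reduction_of_affineIndependent [CompactSpace X] {α : ℕ → X} (hα : DenseRange α)
    {β : ℕ → E} (hβ : DenseRange β) {γ : X → E} (hγ : Continuous γ) (hγi : Function.Injective γ)
    {D : Set Baire} {A : Baire → Set X} (hfin : ∀ p ∈ D, (A p).Finite)
    (hai : ∀ p ∈ D, AffineIndependent ℝ (fun a : A p => γ a))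
    (husc : ∀ p ∈ D, ∀ O, IsOpen O → A p ⊆ O → ∀ᶠ p' in 𝓝[D] p, A p' ⊆ O) :
    ∃ (H K : Baire → Baire) (dK : Set Baire), Continuous H ∧ ContinuousOn K dK ∧
      (∀ p ∈ D, psiMinus β (H p) = convexHull ℝ (γ '' A p)) ∧
      ∀ p ∈ D, ∀ q, ∀ x ∈ convexHull ℝ (γ '' A p), (pointRep β).R q x →
        pairB p q ∈ dK ∧ ∃ y ∈ A p, (pointRep α).R (K (pairB p q)) y := by
  obtain ⟨H, hH, hHD⟩ := exists_continuous_closed_name hβ (D := D)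
    (C := fun p => convexHull ℝ (γ '' A p)) (fun p hp x hx => by
      obtain ⟨ε, hε, hev⟩ := eventually_notMem_convexHull_image hγ (hfin p hp) (husc p hp)
        isOpen_empty (x := x) (by simpa using hx)
      refine ⟨ε, hε, hev.mono fun p' hp' => disjoint_left.2 ?_⟩
      simpa using hp')
  let fstB : Baire → Baire := fun z j => z (2 * j)
  let sndB : Baire → Baire := fun z j => z (2 * j + 1)
  have hfst : Continuous fstB := continuous_pi fun j => continuous_apply _
  have hsnd : Continuous sndB := continuous_pi fun j => continuous_apply _
  have hfst_pair : ∀ p q, fstB (pairB p q) = p := fun p q => by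
    funext j; simp [fstB, pairB]
  have hsnd_pair : ∀ p q, sndB (pairB p q) = q := fun p q => by
    funext j
    have : (2 * j + 1) / 2 = j := by omega
    simp [sndB, pairB, this]
  let D₂ : Set Baire := {z | fstB z ∈ D ∧ ∃ x ∈ convexHull ℝ (γ '' A (fstB z)),
    (pointRep β).R (sndB z) x}
  have hD₂ : ∀ z, Tendsto fstB (𝓝[D₂] z) (𝓝[D] (fstB z)) := fun z =>
    tendsto_nhdsWithin_iff.2 ⟨(hfst.tendsto z).mono_left nhdsWithin_le_nhds,
      eventually_mem_nhdsWithin.mono fun z' hz' => hz'.1⟩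
  let S : Baire → Set X := fun z => {a ∈ A (fstB z) | ∀ x, (pointRep β).R (sndB z) x →
    x ∉ convexHull ℝ (γ '' (A (fstB z) \ {a}))}
  have hS : ∀ z ∈ D₂, ∀ U : Set X, Disjoint (S z) U → ∀ x, (pointRep β).R (sndB z) x →
      x ∈ convexHull ℝ (γ '' (A (fstB z) \ U)) := by
    rintro z ⟨hzD, x, hxC, hx⟩ U hU x₁ hx₁
    obtain rfl := pointRep_unique hx hx₁
    rw [image_sdiff hγi]
    have hai' : AffineIndependent ℝ ((↑) : (γ '' A (fstB z)) → E) := by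
      have := (hai _ hzD).range
      rwa [show range (fun a : A (fstB z) => γ a) = γ '' A (fstB z) by
        rw [image_eq_range]] at this
    refine mem_convexHull_sdiff hai' ((hfin _ hzD).image γ) hxC ?_
    rintro _ ⟨⟨a, ha, rfl⟩, b, hb, hba⟩
    obtain rfl := hγi hba
    by_contra hcon
    refine disjoint_left.1 hU ⟨ha, fun x₂ hx₂ => ?_⟩ hb
    obtain rfl := pointRep_unique hx hx₂
    rwa [image_sdiff hγi, image_singleton]
  obtain ⟨K, hK, hKD⟩ := exists_continuous_point_name hα (D := D₂) (S := S)
    (fun z hz => by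
      by_contra hemp
      obtain ⟨x, hxC, hx⟩ := hz.2
      have := hS z hz univ (by simp [not_nonempty_iff_eq_empty.1 hemp]) x hx
      simp at this)
    (fun z hz => ((hfin _ hz.1).subset (sep_subset _ _)).isClosed)
    (fun z hz a ha r hr => by
      obtain ⟨x, hxC, hx⟩ := hz.2
      obtain ⟨ε, hε, hev⟩ := eventually_notMem_convexHull_image hγ (hfin _ hz.1) (husc _ hz.1)
        (U := ball a r) isOpen_ball (x := x) (fun hmem => ha.2 x hx
          (convexHull_mono (image_mono (sdiff_subset_sdiff_right
            (singleton_subset_iff.2 (mem_ball_self hr)))) hmem))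
      have hclose := (hsnd.tendsto z).eventually (pointRep_eventually_dist_lt hx hε)
      filter_upwards [(hD₂ z).eventually hev, nhdsWithin_le_nhds hclose,
        self_mem_nhdsWithin] with z' h1 h2 hz'
      obtain ⟨x', hxC', hx'⟩ := hz'.2
      by_contra hemp
      exact h1 x' (h2 x' hx') (hS z' hz' _ (disjoint_iff_inter_eq_empty.2
        (not_nonempty_iff_eq_empty.1 hemp)) x' hx'))
  refine ⟨H, K, D₂, hH, hK, hHD, fun p hp q x hxC hx => ?_⟩
  have hz : pairB p q ∈ D₂ := by
    refine ⟨?_, x, ?_, ?_⟩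
    · rwa [hfst_pair]
    · rwa [hfst_pair]
    · rwa [hsnd_pair]
  obtain ⟨y, hy, hyK⟩ := hKD _ hz
  refine ⟨hz, y, ?_, hyK⟩
  have := hy.1
  rwa [hfst_pair] at this

end SimplexValued

section MomentCurve

open Polynomial

/-- The moment curve `t ↦ (t, t², …, tᵐ)`. -/
def momentCurve (m : ℕ) (t : ℝ) : Fin m → ℝ := fun i => t ^ (i.1 + 1)

theorem continuous_momentCurve (m : ℕ) : Continuous (momentCurve m) :=
  continuous_pi fun _ => continuous_pow _

theorem momentCurve_injective {m : ℕ} (hm : 1 ≤ m) : Function.Injective (momentCurve m) :=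
  fun s t h => by simpa [momentCurve] using congrFun h ⟨0, hm⟩

theorem momentCurve_mem_unitCube (m : ℕ) {t : ℝ} (ht : t ∈ Set.Icc (0 : ℝ) 1) :
    momentCurve m t ∈ unitCube m :=
  fun _ _ => ⟨pow_nonneg ht.1 _, pow_le_one₀ ht.1 ht.2⟩

theorem affineIndependent_momentCurve {ι : Type*} [Fintype ι] {m : ℕ} {v : ι → ℝ}
    (hv : Function.Injective v) (hcard : Fintype.card ι ≤ m + 1) :
    AffineIndependent ℝ (fun i => momentCurve m (v i)) := by
  classical
  rw [affineIndependent_iff]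
  intro s w hw hsum e he
  have hpow : ∀ d ≤ m, ∑ j ∈ s, w j * v j ^ d = 0 := by
    rintro (_ | d) hd
    · simpa using hw
    · simpa [momentCurve, Finset.sum_apply] using congrFun hsum ⟨d, hd⟩
  let P : ℝ[X] := ∏ j ∈ s.erase e, (X - C (v j))
  have hdeg : P.natDegree ≤ m := by
    rw [natDegree_finsetProd_X_sub_C_eq_card, Finset.card_erase_of_mem he]
    have := s.card_le_univ
    omega
  have hP : ∑ j ∈ s, w j * P.eval (v j) = 0 := by
    simp_rw [eval_eq_sum_range' (Nat.lt_succ_of_le hdeg), Finset.mul_sum]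
    rw [Finset.sum_comm]
    refine Finset.sum_eq_zero fun d hd => ?_
    have := hpow d (Nat.lt_succ_iff.1 (Finset.mem_range.1 hd))
    rw [← mul_zero (P.coeff d), ← this, Finset.mul_sum]
    exact Finset.sum_congr rfl fun j _ => by ring
  rw [Finset.sum_eq_single e] at hP
  · refine (mul_eq_zero.1 hP).resolve_right ?_
    rw [eval_prod]
    refine Finset.prod_ne_zero_iff.2 fun j hj => ?_
    simpa [sub_eq_zero] using fun h => (Finset.mem_erase.1 hj).1 (hv h).symm
  · intro j hj hje
    rw [eval_prod, Finset.prod_eq_zero (Finset.mem_erase.2 ⟨hje, hj⟩) (by simp), mul_zero]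
  · exact fun h => absurd he h

end MomentCurve

section Boxes

open Set Filter Topology Metric

/-- The `i`-th of the `n` intervals in the definition of `boxClass`. -/
def box (n : ℕ) (i : Fin n) : Set ↥(Icc (0 : ℝ) 1) :=
  {x | 2 * (i : ℝ) / (2 * n) ≤ (x : ℝ) ∧ (x : ℝ) ≤ (2 * (i : ℝ) + 1) / (2 * n)}

/-- The indices of the boxes met by `A`. -/
def boxHits (n : ℕ) (A : Set ↥(Icc (0 : ℝ) 1)) : Set (Fin n) := {i | ∃ x ∈ A, x ∈ box n i}

/-- The indices of the boxes met by `A` above which at least `k` further boxes are met. -/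
def lowHits (n k : ℕ) (A : Set ↥(Icc (0 : ℝ) 1)) : Set (Fin n) :=
  {i ∈ boxHits n A | k ≤ (boxHits n A ∩ Ioi i).ncard}

/-- The points of `A` in boxes above which `A` meets at least `k` further boxes. -/
def lowPart (n k : ℕ) (A : Set ↥(Icc (0 : ℝ) 1)) : Set ↥(Icc (0 : ℝ) 1) :=
  A ∩ ⋃ i ∈ lowHits n k A, box n i

theorem isClosed_box (n : ℕ) (i : Fin n) : IsClosed (box n i) :=
  (isClosed_le continuous_const continuous_subtype_val).inter
    (isClosed_le continuous_subtype_val continuous_const)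

theorem box_disjoint_of_lt {n : ℕ} {i j : Fin n} (hij : i < j) {x : ↥(Icc (0 : ℝ) 1)}
    (hi : x ∈ box n i) (hj : x ∈ box n j) : False := by
  have h := hj.1.trans hi.2
  have hn : (0 : ℝ) < 2 * n := by
    have : 0 < n := i.pos
    positivity
  rw [div_le_div_iff_of_pos_right hn] at h
  have : 2 * (j : ℕ) ≤ 2 * (i : ℕ) + 1 := by exact_mod_cast h
  omega

theorem box_eq_of_mem {n : ℕ} {i j : Fin n} {x : ↥(Icc (0 : ℝ) 1)}
    (hi : x ∈ box n i) (hj : x ∈ box n j) : i = j := by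
  rcases lt_trichotomy i j with h | h | h
  · exact (box_disjoint_of_lt h hi hj).elim
  · exact h
  · exact (box_disjoint_of_lt h hj hi).elim

theorem lowPart_nonempty {n k : ℕ} {A : Set ↥(Icc (0 : ℝ) 1)} (hA : A ∈ boxClass n (k + 1)) :
    (lowPart n k A).Nonempty := by
  have hcard : k + 1 ≤ (boxHits n A).ncard := hA.2.2
  have hne : (boxHits n A).Nonempty := nonempty_of_ncard_ne_zero (by omega)
  obtain ⟨i, hi, hmin⟩ := (toFinite (boxHits n A)).exists_minimal hne
  have hi' : i ∈ lowHits n k A := by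
    refine ⟨hi, ?_⟩
    have h1 : boxHits n A \ {i} ⊆ boxHits n A ∩ Ioi i := fun j hj =>
      ⟨hj.1, lt_of_le_of_ne ((le_total i j).elim id fun h => hmin hj.1 h) fun h => hj.2 h.symm⟩
    have h2 := ncard_le_ncard h1
    rw [ncard_sdiff_singleton_of_mem hi] at h2
    omega
  obtain ⟨x, hxA, hx⟩ := hi
  exact ⟨x, hxA, mem_iUnion₂.2 ⟨i, hi', hx⟩⟩

theorem ncard_lowPart_add_le {n k : ℕ} {A : Set ↥(Icc (0 : ℝ) 1)}
    (hA : A ∈ boxClass n (k + 1)) : (lowPart n k A).ncard + k ≤ n := by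
  obtain ⟨x₀, hx₀, hmem⟩ := lowPart_nonempty hA
  obtain ⟨hfin, hn, -⟩ := hA
  obtain ⟨i₀, hi₀, -⟩ := mem_iUnion₂.1 hmem
  obtain ⟨i, hi, hmax⟩ := (toFinite (lowHits n k A)).exists_maximal ⟨i₀, hi₀⟩
  have hx : ∀ j : Fin n, ∃ x, j ∈ boxHits n A → x ∈ A ∧ x ∈ box n j := fun j => by
    by_cases hj : j ∈ boxHits n A
    · obtain ⟨x, h⟩ := hj
      exact ⟨x, fun _ => h⟩
    · exact ⟨x₀, fun h => absurd h hj⟩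
  choose x hx using hx
  have hmaps : x '' (boxHits n A ∩ Ioi i) ⊆ A \ lowPart n k A := by
    rintro _ ⟨j, ⟨hj, hij⟩, rfl⟩
    refine ⟨(hx j hj).1, fun hlow => ?_⟩
    obtain ⟨l, hl, hxl⟩ := mem_iUnion₂.1 hlow.2
    obtain rfl := box_eq_of_mem hxl (hx j hj).2
    exact absurd (hmax hl (le_of_lt hij)) (not_le.2 hij)
  have hinj : InjOn x (boxHits n A ∩ Ioi i) := fun j hj l hl h =>
    box_eq_of_mem (hx j hj.1).2 (h ▸ (hx l hl.1).2)
  have h1 := ncard_le_ncard hmaps (hfin.subset sdiff_subset)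
  rw [hinj.ncard_image] at h1
  have h2 := ncard_sdiff_add_ncard_of_subset (s := lowPart n k A) (t := A) inter_subset_left hfin
  have := hi.2
  omega

theorem eventually_lowPart_subset (α : ℕ → ↥(Icc (0 : ℝ) 1)) (n k : ℕ) (p : Baire)
    {O : Set ↥(Icc (0 : ℝ) 1)} (hO : IsOpen O) (h : lowPart n k (psiMinus α p) ⊆ O) :
    ∀ᶠ p' in 𝓝 p, lowPart n k (psiMinus α p') ⊆ O := by
  set A := psiMinus α p
  have hc1 : IsClosed (⋃ i ∈ (boxHits n A)ᶜ, box n i) :=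
    (toFinite _).isClosed_biUnion fun i _ => isClosed_box n i
  have hc2 : IsClosed (⋃ i ∈ lowHits n k A, box n i) :=
    (toFinite _).isClosed_biUnion fun i _ => isClosed_box n i
  have hev1 := eventually_inter_psiMinus_subset α (isCompact_univ) hc1.isOpen_compl (p := p)
    (fun x hx hx' => by
      obtain ⟨i, hi, hxi⟩ := mem_iUnion₂.1 hx'
      exact hi ⟨x, hx.2, hxi⟩)
  have hev2 := eventually_inter_psiMinus_subset α (isCompact_univ) (hO.union hc2.isOpen_compl)
    (p := p) (fun x hx => by
      by_cases hx' : x ∈ ⋃ i ∈ lowHits n k A, box n i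
      · exact Or.inl (h ⟨hx.2, hx'⟩)
      · exact Or.inr hx')
  filter_upwards [hev1, hev2] with p' h1 h2 x hx
  rw [univ_inter] at h1 h2
  have hhits : boxHits n (psiMinus α p') ⊆ boxHits n A := by
    rintro i ⟨y, hy, hyi⟩
    by_contra hi
    exact h1 hy (mem_iUnion₂.2 ⟨i, hi, hyi⟩)
  refine (h2 hx.1).resolve_right fun hx' => hx' ?_
  obtain ⟨i, hi, hxi⟩ := mem_iUnion₂.1 hx.2
  exact mem_iUnion₂.2 ⟨i, ⟨hhits hi.1, hi.2.trans
    (ncard_le_ncard (inter_subset_inter_left _ hhits))⟩, hxi⟩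

/-- If at most `m + 1` points can lie outside of `k` of the boxes met by an `n`-element set, then
choice from such sets reduces to convex choice in dimension `m`. -/
theorem wRed_boxClass_convexClass {n k m : ℕ} (hm : 1 ≤ m) (hnk : n ≤ k + m + 1)
    {α : ℕ → ↥(Icc (0 : ℝ) 1)} (hα : DenseRange α) {β : ℕ → (Fin m → ℝ)} (hβ : DenseRange β) :
    WRed (closedRep α) (pointRep α) (closedRep β) (pointRep β)
      (choiceFn (boxClass n (k + 1))) (choiceFn (convexClass m)) := by
  let D : Set Baire := {p | psiMinus α p ∈ boxClass n (k + 1)}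
  let A : Baire → Set ↥(Icc (0 : ℝ) 1) := fun p => lowPart n k (psiMinus α p)
  let γ : ↥(Icc (0 : ℝ) 1) → (Fin m → ℝ) := fun x => momentCurve m x
  have hγ : Continuous γ := (continuous_momentCurve m).comp continuous_subtype_val
  have hγi : Function.Injective γ := (momentCurve_injective hm).comp Subtype.val_injective
  have hfin : ∀ p ∈ D, (A p).Finite := fun p hp => hp.1.subset inter_subset_left
  obtain ⟨H, K, dK, hH, hK, hHD, hKD⟩ := exists_reduction_of_affineIndependent hα hβ hγ hγi hfin
    (fun p hp => by
      have := (hfin p hp).fintype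
      refine affineIndependent_momentCurve (v := fun a : A p => ((a : ↥(Icc (0 : ℝ) 1)) : ℝ))
        (Subtype.val_injective.comp Subtype.val_injective) ?_
      have h := ncard_lowPart_add_le hp
      rw [← Nat.card_eq_fintype_card, Nat.card_coe_set_eq]
      change (lowPart n k (psiMinus α p)).ncard ≤ _
      omega)
    (fun p _ O hO h => nhdsWithin_le_nhds (eventually_lowPart_subset α n k p hO h))
  refine ⟨H, K, univ, dK, hH.continuousOn, hK, fun G hG p x hpx hx => ?_⟩
  obtain rfl : x = psiMinus α p := hpx
  have hpD : p ∈ D := hx.some_mem.1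
  have hne : (convexHull ℝ (γ '' A p)).Nonempty :=
    ((lowPart_nonempty hpD).image γ).convexHull
  have hconv : psiMinus β (H p) ∈ convexClass m := by
    rw [hHD p hpD]
    refine ⟨hne, (((hfin p hpD).image γ).isCompact_convexHull ℝ).isClosed, convex_convexHull ℝ _,
      convexHull_min ?_ (convex_pi fun _ _ => convex_Icc 0 1)⟩
    rintro _ ⟨a, -, rfl⟩
    exact momentCurve_mem_unitCube m a.2
  obtain ⟨y, hy, hyG⟩ := hG (H p) _ rfl ⟨_, hconv, hconv.1.some_mem⟩
  obtain ⟨hdK, z, hz, hzK⟩ := hKD p hpD (G (H p)) y (hHD p hpD ▸ hy.2) hyG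
  exact ⟨mem_univ _, hdK, z, ⟨hpD, hz.1⟩, hzK⟩

end Boxes

section GoodNames

open Set Filter Topology Metric

variable {X : Type*} [MetricSpace X]

/-- A name of a closed set that keeps the set away from the closures of the enumerated balls. -/
def IsGoodName (α : ℕ → X) (z : Baire) : Prop :=
  ∀ i, Disjoint (psiMinus α z) (closure (ballCode α (z i)))

theorem exists_isGoodName_agree {α : ℕ → X} (hα : DenseRange α) {z : Baire} {l : ℕ} {B : Set X}
    (hB : IsClosed B) (hBz : ∀ i < l, Disjoint B (closure (ballCode α (z i)))) :
    ∃ z', IsGoodName α z' ∧ psiMinus α z' = B ∧ ∀ i < l, z' i = z i := by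
  classical
  let z' : Baire := fun i =>
    if i < l then z i else if Disjoint B (closure (ballCode α (i - l))) then i - l else 0
  have hdisj : ∀ i, Disjoint B (closure (ballCode α (z' i))) := by
    intro i
    simp only [z']
    split_ifs with h1 h2
    · exact hBz i h1
    · exact h2
    · simp [ballCode_zero]
  have heq : psiMinus α z' = B := by
    ext x
    refine ⟨fun hx => ?_, fun hx i hxi => disjoint_left.1 (hdisj i) hx (subset_closure hxi)⟩
    by_contra hxB
    obtain ⟨ε, hε, hsub⟩ := Metric.isOpen_iff.1 hB.isOpen_compl x hxB
    obtain ⟨c, hxc, hc⟩ := exists_mem_ballCode hα x hε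
    have hBc : Disjoint B (closure (ballCode α c)) :=
      (disjoint_left.2 fun b hb hb' => hsub hb' hb).mono_right hc
    refine hx (l + c) ?_
    simpa [z', hBc] using hxc
  exact ⟨z', fun i => heq ▸ hdisj i, heq, fun i hi => by simp [z', hi]⟩

theorem exists_isGoodName {α : ℕ → X} (hα : DenseRange α) {B : Set X} (hB : IsClosed B) :
    ∃ z, IsGoodName α z ∧ psiMinus α z = B := by
  obtain ⟨z, h1, h2, -⟩ := exists_isGoodName_agree hα (z := 0) (l := 0) hB (by simp)
  exact ⟨z, h1, h2⟩

/-- Near a good name of `A` there are good names of all closed sets close to `A`. -/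
theorem IsGoodName.exists_isOpen {α : ℕ → X} (hα : DenseRange α) {z : Baire}
    (hz : IsGoodName α z) {N : Set Baire} (hN : N ∈ 𝓝 z) :
    ∃ O, IsOpen O ∧ psiMinus α z ⊆ O ∧
      ∀ B ⊆ O, IsClosed B → ∃ z' ∈ N, IsGoodName α z' ∧ psiMinus α z' = B := by
  obtain ⟨l, hl⟩ := Baire.exists_agree_of_mem_nhds hN
  refine ⟨⋂ i ∈ Finset.range l, (closure (ballCode α (z i)))ᶜ,
    isOpen_biInter_finset fun i _ => isClosed_closure.isOpen_compl,
    subset_iInter₂ fun i _ => (hz i).subset_compl_right, fun B hBO hB => ?_⟩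
  obtain ⟨z', h1, h2, h3⟩ := exists_isGoodName_agree hα (z := z) (l := l) hB fun i hi =>
    subset_compl_iff_disjoint_right.1
      (hBO.trans (iInter₂_subset i (Finset.mem_range.2 hi)))
  exact ⟨z', hl z' h3, h1, h2⟩

/-- The good names of `n`-element sets that are contained in the union of a family of sets and
meet each of its members. -/
def transversalNames (α : ℕ → X) (n : ℕ) {ι : Type} (U : ι → Set X) : Set Baire :=
  {z | IsGoodName α z ∧ (psiMinus α z).Finite ∧ (psiMinus α z).ncard = n ∧
    psiMinus α z ⊆ ⋃ i, U i ∧ ∀ i, (psiMinus α z ∩ U i).Nonempty}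

theorem exists_finite_extension (hinf : ∀ O : Set X, IsOpen O → O.Nonempty → O.Infinite)
    {n : ℕ} {ι : Type} [Fintype ι] {a : ι → X} (ha : Function.Injective a)
    (hn : Fintype.card ι ≤ n) {V : Set X} (hV : IsOpen V) (hVne : V.Nonempty) :
    ∃ B : Set X, B.Finite ∧ B.ncard = n ∧ range a ⊆ B ∧ B ⊆ range a ∪ V := by
  classical
  have hVinf : (V \ range a).Infinite := (hinf V hV hVne).sdiff (finite_range a)
  obtain ⟨t, htV, ht⟩ := hVinf.exists_subset_card_eq (n - Fintype.card ι)
  refine ⟨range a ∪ t, (finite_range a).union t.finite_toSet, ?_, subset_union_left,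
    union_subset_union_right _ (htV.trans sdiff_subset)⟩
  rw [ncard_union_eq (disjoint_left.2 fun x hx hxt => (htV hxt).2 hx) (finite_range a)
    t.finite_toSet, ncard_coe_finset, ht, ← image_univ, ncard_image_of_injective _ ha, ncard_univ,
    Nat.card_eq_fintype_card]
  omega

theorem injective_of_mem_of_pairwise_disjoint {X : Type*} {ι : Type} {U : ι → Set X}
    (hU : Pairwise (Function.onFun Disjoint U)) {a : ι → X} (ha : ∀ i, a i ∈ U i) :
    Function.Injective a := by
  intro i j hij
  by_contra hne
  exact disjoint_left.1 (hU hne) (ha i) (hij ▸ ha j)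

theorem transversalNames_nonempty {α : ℕ → X} (hα : DenseRange α)
    (hinf : ∀ O : Set X, IsOpen O → O.Nonempty → O.Infinite)
    {n : ℕ} {ι : Type} [Fintype ι] [Nonempty ι] {U : ι → Set X} (hUo : ∀ i, IsOpen (U i))
    (hUne : ∀ i, (U i).Nonempty) (hU : Pairwise (Function.onFun Disjoint U))
    (hn : Fintype.card ι ≤ n) : (transversalNames α n U).Nonempty := by
  choose a ha using hUne
  obtain ⟨i⟩ := ‹Nonempty ι›
  obtain ⟨B, hBfin, hBn, haB, hBV⟩ := exists_finite_extension hinf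
    (injective_of_mem_of_pairwise_disjoint hU ha) hn (hUo i) ⟨a i, ha i⟩
  obtain ⟨z, hz, rfl⟩ := exists_isGoodName hα hBfin.isClosed
  refine ⟨z, hz, hBfin, hBn, fun x hx => ?_, fun j => ⟨a j, haB ⟨j, rfl⟩, ha j⟩⟩
  rcases hBV hx with ⟨j, rfl⟩ | hxV
  · exact mem_iUnion.2 ⟨j, ha j⟩
  · exact mem_iUnion.2 ⟨i, hxV⟩

/-- All points of a set but one transversal can be moved into a prescribed open set. -/
theorem exists_transversalNames_subset {α : ℕ → X} (hα : DenseRange α)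
    (hinf : ∀ O : Set X, IsOpen O → O.Nonempty → O.Infinite)
    {n : ℕ} {ι : Type} [Fintype ι] {U : ι → Set X}
    (hU : Pairwise (Function.onFun Disjoint U)) (hn : Fintype.card ι ≤ n) {z : Baire}
    (hz : z ∈ transversalNames α n U) {W : Set Baire} (hW : W ∈ 𝓝 z) {a : ι → X}
    (ha : ∀ i, a i ∈ psiMinus α z ∩ U i) {i₀ : ι} {V : Set X} (hV : IsOpen V)
    (haV : a i₀ ∈ V) (hVU : V ⊆ U i₀) :
    ∃ z' ∈ transversalNames α n U ∩ W,
      range a ⊆ psiMinus α z' ∧ psiMinus α z' ⊆ range a ∪ V := by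
  obtain ⟨O, hO, hzO, hext⟩ := hz.1.exists_isOpen hα hW
  obtain ⟨B, hBfin, hBn, haB, hBV⟩ := exists_finite_extension hinf
    (injective_of_mem_of_pairwise_disjoint hU fun i => (ha i).2) hn (hV.inter hO)
    ⟨a i₀, haV, hzO (ha i₀).1⟩
  obtain ⟨z', hz'W, hz', rfl⟩ := hext B (fun x hx => by
    rcases hBV hx with ⟨i, rfl⟩ | hxV
    · exact hzO (ha i).1
    · exact hxV.2) hBfin.isClosed
  refine ⟨z', ⟨⟨hz', hBfin, hBn, fun x hx => ?_, fun i => ⟨a i, haB ⟨i, rfl⟩, (ha i).2⟩⟩, hz'W⟩,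
    haB, hBV.trans (union_subset_union_right _ inter_subset_left)⟩
  rcases hBV hx with ⟨i, rfl⟩ | hxV
  · exact mem_iUnion.2 ⟨i, (ha i).2⟩
  · exact mem_iUnion.2 ⟨i₀, hVU hxV.1⟩

end GoodNames

section SmallValues

open Set Filter Topology Metric

theorem exists_mul_mem_Icc {a b η : ℝ} (hη : 0 < η) (ha : 0 ≤ a) (hb : b ≤ 1)
    (hab : a + η ≤ b) : ∃ j < ⌈2 / η⌉₊ + 1, (j : ℝ) * (η / 2) ∈ Icc a b := by
  refine ⟨⌈a * (2 / η)⌉₊, Nat.lt_succ_of_le (Nat.ceil_mono ?_), ?_, ?_⟩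
  · exact mul_le_of_le_one_left (by positivity) (by linarith)
  · have h := Nat.le_ceil (a * (2 / η))
    calc a = a * (2 / η) * (η / 2) := by field_simp
      _ ≤ _ := by gcongr
  · have h := (Nat.ceil_lt_add_one (a := a * (2 / η)) (by positivity)).le
    calc _ ≤ (a * (2 / η) + 1) * (η / 2) := by gcongr
      _ = a + η / 2 := by field_simp
      _ ≤ b := by linarith

/-- An upper semicontinuous map with convex compact values either has arbitrarily small values, or
all its values near some point meet a common coordinate hyperplane. -/
theorem exists_small_value_or_slice {d : ℕ} {D : Set Baire} (hD : D.Nonempty)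
    {F : Baire → Set (Fin d → ℝ)} (hconv : ∀ z ∈ D, Convex ℝ (F z))
    (hcube : ∀ z ∈ D, F z ⊆ unitCube d)
    (husc : ∀ z ∈ D, ∀ O, IsOpen O → F z ⊆ O → ∀ᶠ z' in 𝓝[D] z, F z' ⊆ O)
    {η : ℝ} (hη : 0 < η) :
    (∃ z ∈ D, ∀ x ∈ F z, ∀ y ∈ F z, dist x y < η) ∨
      ∃ z ∈ D, ∃ W, IsOpen W ∧ z ∈ W ∧ ∃ (i : Fin d) (r : ℝ),
        (∃ x ∈ F z, ∃ y ∈ F z, x i ≠ y i) ∧ ∀ z' ∈ D ∩ W, ∃ x ∈ F z', x i = r := by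
  classical
  refine or_iff_not_imp_left.2 fun hnot => ?_
  push Not at hnot
  let T : Finset (Fin d × ℕ) := Finset.univ ×ˢ Finset.range (⌈2 / η⌉₊ + 1)
  let S : Baire → Finset (Fin d × ℕ) := fun z =>
    T.filter fun t => ∃ x ∈ F z, x t.1 = t.2 * (η / 2)
  obtain ⟨z, hz, hmin⟩ : ∃ z ∈ D, ∀ z' ∈ D, (S z).card ≤ (S z').card := by
    obtain ⟨z, hz, hmin⟩ := exists_minimalFor_of_wellFoundedLT (· ∈ D) (fun z => (S z).card) hD
    exact ⟨z, hz, fun z' hz' => (le_total _ _).elim id fun h => hmin hz' h⟩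
  have hev : ∀ᶠ z' in 𝓝[D] z, ∀ t ∈ T, t ∉ S z → t ∉ S z' := by
    refine (eventually_all_finset T).2 fun t ht => ?_
    by_cases hts : t ∈ S z
    · simp [hts]
    · have hopen : IsOpen {x : Fin d → ℝ | x t.1 ≠ t.2 * (η / 2)} :=
        isOpen_ne_fun (continuous_apply _) continuous_const
      filter_upwards [husc z hz _ hopen fun x hx hxt =>
        hts (Finset.mem_filter.2 ⟨ht, x, hx, hxt⟩)] with z' hz' _ htz'
      obtain ⟨x, hx, hxt⟩ := (Finset.mem_filter.1 htz').2
      exact hz' hx hxt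
  obtain ⟨W, hW, hzW, hWD⟩ := mem_nhdsWithin.1 hev
  obtain ⟨x, hx, y, hy, hxy⟩ := hnot z hz
  obtain ⟨i, x, hx, y, hy, hxy⟩ : ∃ i, ∃ x ∈ F z, ∃ y ∈ F z, x i + η ≤ y i := by
    have : ¬ ∀ i, dist (x i) (y i) < η := fun h => not_lt.2 hxy ((dist_pi_lt_iff hη).2 h)
    push Not at this
    obtain ⟨i, hi⟩ := this
    rw [Real.dist_eq, le_abs] at hi
    rcases hi with hi | hi
    · exact ⟨i, y, hy, x, hx, by linarith⟩
    · exact ⟨i, x, hx, y, hy, by linarith⟩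
  obtain ⟨j, hj, hmem⟩ := exists_mul_mem_Icc hη (hcube z hz hx i (mem_univ i)).1
    (hcube z hz hy i (mem_univ i)).2 hxy
  have hzT : (i, j) ∈ S z := by
    refine Finset.mem_filter.2 ⟨by simpa [T] using hj, ?_⟩
    have hoc := ((hconv z hz).linear_image (LinearMap.proj (R := ℝ) i)).ordConnected
    obtain ⟨w, hw, hwi⟩ := hoc.out (mem_image_of_mem _ hx) (mem_image_of_mem _ hy) hmem
    exact ⟨w, hw, hwi⟩
  refine ⟨z, hz, W, hW, hzW, i, j * (η / 2), ⟨x, hx, y, hy, by linarith⟩, fun z' hz' => ?_⟩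
  have hsub : S z' ⊆ S z := fun t ht => by
    by_contra hts
    exact hWD ⟨hz'.2, hz'.1⟩ t (Finset.mem_filter.1 ht).1 hts ht
  have hmem' : (i, j) ∈ S z' := by
    rwa [Finset.eq_of_subset_of_card_le hsub (hmin z' hz'.1)]
  exact (Finset.mem_filter.1 hmem').2

end SmallValues

section Answers

open Set Filter Topology Metric

variable {X E : Type*} [MetricSpace X] [MetricSpace E]

/-- For inputs in `D`, the post-processor `K` maps a suitable name of any given point of `F z` to
a name of a point in `V`. -/
def AnswersIn (α : ℕ → X) (β : ℕ → E) (K : Baire → Baire) (dK : Set Baire)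
    (F : Baire → Set E) (V : Set X) (D : Set Baire) : Prop :=
  ∀ z ∈ D, ∀ x ∈ F z, ∃ q, (pointRep β).R q x ∧ pairB z q ∈ dK ∧
    ∃ y ∈ psiMinus α z ∩ V, (pointRep α).R (K (pairB z q)) y

theorem AnswersIn.exists_ball {α : ℕ → X} {β : ℕ → E} (hβ : DenseRange β)
    {K : Baire → Baire} {dK : Set Baire} (hK : ContinuousOn K dK) {F : Baire → Set E}
    {V : Set X} {D : Set Baire} (hans : AnswersIn α β K dK F V D)
    (husc : ∀ z ∈ D, ∀ O, IsOpen O → F z ⊆ O → ∀ᶠ z' in 𝓝[D] z, F z' ⊆ O)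
    (hsol : ∀ z ∈ D, ∀ x ∈ F z, ∀ q, (pointRep β).R q x →
      pairB z q ∈ dK ∧ ∃ y ∈ psiMinus α z, (pointRep α).R (K (pairB z q)) y)
    {z₀ : Baire} (hz₀ : z₀ ∈ D) (hcomp : IsCompact (F z₀)) {ε : ℝ} (hε : 0 < ε) :
    ∃ η > 0, ∀ᶠ z₁ in 𝓝[D] z₀, (F z₁).Nonempty →
      (∀ x ∈ F z₁, ∀ y ∈ F z₁, dist x y < η) →
      ∃ y₀ ∈ psiMinus α z₀ ∩ V, ∃ W, IsOpen W ∧ z₁ ∈ W ∧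
        AnswersIn α β K dK F (ball y₀ ε) (D ∩ W) := by
  have hloc : ∀ x ∈ F z₀, ∃ δ > 0, ∃ l : ℕ, ∃ y ∈ psiMinus α z₀ ∩ V, ∀ z ∈ D,
      (∀ i < l, z i = z₀ i) → ∀ x' ∈ F z ∩ ball x δ, ∃ q, (pointRep β).R q x' ∧
        pairB z q ∈ dK ∧ ∃ y' ∈ psiMinus α z ∩ ball y ε, (pointRep α).R (K (pairB z q)) y' := by
    intro x hx
    obtain ⟨q, hq, hqdK, y, hy, hyK⟩ := hans z₀ hz₀ x hx
    obtain ⟨l, hl⟩ := Baire.exists_agree_of_eventually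
      ((hK _ hqdK).eventually (pointRep_eventually_dist_lt hyK hε))
    obtain ⟨δ, hδ, hδl⟩ := Metric.eventually_nhds_iff_ball.1
      (pointRep_eventually_exists_agree hβ hq l)
    refine ⟨δ, hδ, l, y, hy, fun z hz hagree x' hx' => ?_⟩
    obtain ⟨q', hq', hqq'⟩ := hδl x' hx'.2
    obtain ⟨hdK, y', hy', hyK'⟩ := hsol z hz x' hx'.1 q' hq'
    refine ⟨q', hq', hdK, y', ⟨hy', hl _ hdK (fun i hi => ?_) y' hyK'⟩, hyK'⟩
    simp only [pairB]
    rw [hagree _ (by omega), hqq' _ (by omega)]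
  have : Nonempty X := ⟨α 0⟩
  choose! δ hδ l y hy hloc using hloc
  obtain ⟨t, ht, hcov⟩ := hcomp.elim_nhds_subcover (fun x => ball x (δ x / 2))
    (fun x hx => ball_mem_nhds x (half_pos (hδ x hx)))
  obtain ⟨η, hη, hηt⟩ : ∃ η > 0, ∀ x ∈ t, η < δ x / 2 := by
    have h1 : ∀ᶠ η : ℝ in 𝓝[>] 0, ∀ x ∈ t, η < δ x / 2 :=
      (eventually_all_finset t).2 fun x hx =>
        nhdsWithin_le_nhds (Iio_mem_nhds (half_pos (hδ x (ht x hx))))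
    obtain ⟨η, h2, h3⟩ := (h1.and self_mem_nhdsWithin).exists
    exact ⟨η, h3, h2⟩
  have hagree : ∀ᶠ z in 𝓝[D] z₀, ∀ x ∈ t, ∀ i < l x, z i = z₀ i :=
    nhdsWithin_le_nhds ((eventually_all_finset t).2 fun x _ => Baire.eventually_agree z₀ (l x))
  refine ⟨η, hη, ?_⟩
  filter_upwards [hagree, husc z₀ hz₀ _ (isOpen_biUnion fun x _ => isOpen_ball) hcov,
    self_mem_nhdsWithin] with z₁ hz₁l hz₁F hz₁ hne hsmall
  obtain ⟨p, hp⟩ := hne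
  obtain ⟨x, hxt, hpx⟩ := mem_iUnion₂.1 (hz₁F hp)
  have hball : F z₁ ⊆ ball x (δ x) := fun w hw => by
    have h1 := hsmall w hw p hp
    have h2 := hηt x hxt
    have h3 := dist_triangle w p x
    rw [mem_ball] at hpx ⊢
    linarith
  have hev := (husc z₁ hz₁ _ isOpen_ball hball).and
    (nhdsWithin_le_nhds (Baire.eventually_agree z₁ (l x)))
  obtain ⟨W, hW, hzW, hWD⟩ := mem_nhdsWithin.1 hev
  refine ⟨y x, hy x (ht x hxt), W, hW, hzW, fun z hz w hw => ?_⟩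
  obtain ⟨h1, h2⟩ := hWD ⟨hz.2, hz.1⟩
  exact hloc x (ht x hxt) z hz.1 (fun i hi => (h2 i hi).trans (hz₁l x hxt i hi)) w ⟨hw, h1 hw⟩

end Answers

section Splitting

open Set Filter Topology Metric

variable {X E : Type*} [MetricSpace X] [MetricSpace E]

theorem exists_split_transversalNames {α : ℕ → X} {n : ℕ} {ι : Type} {U : ι → Set X}
    (hUo : ∀ i, IsOpen (U i)) (hU : Pairwise (Function.onFun Disjoint U)) {z : Baire}
    (hz : z ∈ transversalNames α n U) {i₀ : ι} {a b : X} (ha : a ∈ psiMinus α z ∩ U i₀)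
    (hb : b ∈ psiMinus α z ∩ U i₀) (hab : a ≠ b) :
    ∃ (V : Bool → Set X) (U' : Option ι → Set X), (∀ t, IsOpen (V t)) ∧ (∀ t, V t ⊆ U i₀) ∧
      (∀ t, Disjoint (V t) (V !t)) ∧ psiMinus α z ∩ U i₀ ⊆ ⋃ t, V t ∧
      (∀ i, IsOpen (U' i)) ∧ Pairwise (Function.onFun Disjoint U') ∧
      z ∈ transversalNames α n U' ∧ transversalNames α n U' ⊆ transversalNames α n U ∧
      ∀ z' ∈ transversalNames α n U', ∀ t, (psiMinus α z' ∩ V t).Nonempty := by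
  classical
  obtain ⟨ρ, hρ, hρsub⟩ := Metric.isOpen_iff.1
    (hz.2.1.subset (sdiff_subset (t := {a}))).isClosed.isOpen_compl a (by simp)
  have hfar : ∀ x ∈ psiMinus α z, x ≠ a → x ∈ (closedBall a (ρ / 2))ᶜ := fun x hx hxa hmem =>
    hρsub (closedBall_subset_ball (half_lt_self hρ) hmem) ⟨hx, hxa⟩
  let V₁ : Set X := U i₀ ∩ ball a (ρ / 2)
  let V₂ : Set X := U i₀ ∩ (closedBall a (ρ / 2))ᶜ
  have hV : Disjoint V₁ V₂ := disjoint_left.2 fun x h1 h2 => h2.2 (ball_subset_closedBall h1.2)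
  have hV₁ : IsOpen V₁ := (hUo i₀).inter isOpen_ball
  have hV₂ : IsOpen V₂ := (hUo i₀).inter isClosed_closedBall.isOpen_compl
  have haV : a ∈ V₁ := ⟨ha.2, mem_ball_self (half_pos hρ)⟩
  have hcov : ∀ x ∈ psiMinus α z ∩ U i₀, x ∈ V₁ ∨ x ∈ V₂ := fun x hx => by
    by_cases hxa : x = a
    · exact Or.inl (hxa ▸ haV)
    · exact Or.inr ⟨hx.2, hfar x hx.1 hxa⟩
  let U₁ : ι → Set X := Function.update U i₀ V₁
  have hU₁ : ∀ i, U₁ i ⊆ U i := fun i => by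
    by_cases hi : i = i₀
    · subst hi
      exact (Function.update_self i V₁ U).subset.trans inter_subset_left
    · simp [U₁, hi]
  let U' : Option ι → Set X := fun o => o.elim V₂ U₁
  have hU'₁ : U' (some i₀) = V₁ := by simp [U', U₁]
  have hU'sub : ∀ o, ∃ i, U' o ⊆ U i
    | none => ⟨i₀, inter_subset_left⟩
    | some i => ⟨i, hU₁ i⟩
  have hdisj : ∀ i, Disjoint V₂ (U₁ i) := fun i => by
    by_cases hi : i = i₀
    · subst hi
      simpa [U₁] using hV.symm
    · exact (hU (Ne.symm hi)).mono inter_subset_left (hU₁ i)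
  refine ⟨fun t => cond t V₁ V₂, U', ?_, ?_, ?_, ?_, ?_, ?_, ?_, ?_, ?_⟩
  · exact Bool.forall_bool.2 ⟨hV₂, hV₁⟩
  · exact Bool.forall_bool.2 ⟨inter_subset_left, inter_subset_left⟩
  · exact Bool.forall_bool.2 ⟨hV.symm, hV⟩
  · intro x hx
    rcases hcov x hx with h | h
    · exact mem_iUnion.2 ⟨true, h⟩
    · exact mem_iUnion.2 ⟨false, h⟩
  · rintro (_ | i)
    · exact hV₂
    · by_cases hi : i = i₀
      · subst hi
        rwa [hU'₁]
      · simpa [U', U₁, hi] using hUo i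
  · rintro (_ | i) (_ | j) hij
    · exact absurd rfl hij
    · exact hdisj j
    · exact (hdisj i).symm
    · exact (hU fun h => hij (congrArg some h)).mono (hU₁ i) (hU₁ j)
  · refine ⟨hz.1, hz.2.1, hz.2.2.1, fun x hx => ?_, ?_⟩
    · obtain ⟨i, hi⟩ := mem_iUnion.1 (hz.2.2.2.1 hx)
      by_cases hii : i = i₀
      · subst hii
        rcases hcov x ⟨hx, hi⟩ with h | h
        · exact mem_iUnion.2 ⟨some i, by rwa [hU'₁]⟩
        · exact mem_iUnion.2 ⟨none, h⟩
      · exact mem_iUnion.2 ⟨some i, by simpa [U', U₁, hii] using hi⟩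
    · rintro (_ | i)
      · exact ⟨b, hb.1, hb.2, hfar b hb.1 hab.symm⟩
      · by_cases hi : i = i₀
        · subst hi
          rw [hU'₁]
          exact ⟨a, ha.1, haV⟩
        · simpa [U', U₁, hi] using hz.2.2.2.2 i
  · intro z' hz'
    refine ⟨hz'.1, hz'.2.1, hz'.2.2.1, hz'.2.2.2.1.trans (iUnion_subset fun o => ?_), fun i => ?_⟩
    · obtain ⟨i, hi⟩ := hU'sub o
      exact subset_iUnion_of_subset i hi
    · exact (hz'.2.2.2.2 (some i)).mono (inter_subset_inter_right _ (hU₁ i))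
  · intro z' hz'
    refine Bool.forall_bool.2 ⟨hz'.2.2.2.2 none, ?_⟩
    have := hz'.2.2.2.2 (some i₀)
    rwa [hU'₁] at this

/-- If arbitrarily small solution sets occur near every input, even after splitting one of the
sets `U i`, then no continuous post-processing can find points of the input sets. -/
theorem false_of_small_values {α : ℕ → X} (hα : DenseRange α)
    (hinf : ∀ O : Set X, IsOpen O → O.Nonempty → O.Infinite) {β : ℕ → E} (hβ : DenseRange β)
    {K : Baire → Baire} {dK : Set Baire} (hK : ContinuousOn K dK) {n : ℕ}
    {ι : Type} [Fintype ι] {U : ι → Set X} (hUo : ∀ i, IsOpen (U i))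
    (hU : Pairwise (Function.onFun Disjoint U)) {W : Set Baire} (hW : IsOpen W)
    (hne : (transversalNames α n U ∩ W).Nonempty) (hn : Fintype.card ι < n)
    {F : Baire → Set E} (hFne : ∀ z ∈ transversalNames α n U ∩ W, (F z).Nonempty)
    (hcomp : ∀ z ∈ transversalNames α n U ∩ W, IsCompact (F z))
    (husc : ∀ z ∈ transversalNames α n U ∩ W, ∀ O, IsOpen O → F z ⊆ O →
      ∀ᶠ z' in 𝓝[transversalNames α n U ∩ W] z, F z' ⊆ O)
    (hsol : ∀ z ∈ transversalNames α n U ∩ W, ∀ x ∈ F z, ∀ q, (pointRep β).R q x →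
      pairB z q ∈ dK ∧ ∃ y ∈ psiMinus α z, (pointRep α).R (K (pairB z q)) y)
    (hsmall : ∀ (κ : Type) [Fintype κ] (U' : κ → Set X) (W' : Set Baire),
      Fintype.card κ ≤ Fintype.card ι + 1 → (∀ i, IsOpen (U' i)) →
      Pairwise (Function.onFun Disjoint U') → IsOpen W' →
      (transversalNames α n U' ∩ W').Nonempty →
      transversalNames α n U' ∩ W' ⊆ transversalNames α n U ∩ W → ∀ η > 0,
      ∃ z ∈ transversalNames α n U' ∩ W', ∀ x ∈ F z, ∀ y ∈ F z, dist x y < η) : False := by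
  classical
  obtain ⟨z₀, hz₀⟩ := hne
  obtain ⟨ε₀, hε₀, hball₀⟩ := lebesgue_number_lemma_of_metric hz₀.1.2.1.isCompact hUo
    hz₀.1.2.2.2.1
  have hans : AnswersIn α β K dK F univ (transversalNames α n U ∩ W) := fun z hz x hx => by
    obtain ⟨q, hq⟩ := pointRep_exists hβ x
    obtain ⟨h1, y, hy, h2⟩ := hsol z hz x hx q hq
    exact ⟨q, hq, h1, y, ⟨hy, mem_univ y⟩, h2⟩
  obtain ⟨η₁, hη₁, hev₁⟩ := hans.exists_ball hβ hK husc hsol hz₀ (hcomp z₀ hz₀) hε₀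
  obtain ⟨W₁, hW₁, hz₀W₁, hW₁sub⟩ := mem_nhdsWithin.1 hev₁
  obtain ⟨z₁, hz₁, hz₁small⟩ := hsmall ι U (W ∩ W₁) (Nat.le_succ _) hUo hU (hW.inter hW₁)
    ⟨z₀, hz₀.1, hz₀.2, hz₀W₁⟩ (inter_subset_inter_right _ inter_subset_left) η₁ hη₁
  have hz₁D : z₁ ∈ transversalNames α n U ∩ W := ⟨hz₁.1, hz₁.2.1⟩
  obtain ⟨y₀, hy₀, W₂, hW₂, hz₁W₂, hans₂⟩ := hW₁sub ⟨hz₁.2.2, hz₁D⟩ (hFne z₁ hz₁D) hz₁small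
  obtain ⟨i₀, hi₀⟩ := hball₀ y₀ hy₀.1
  choose a ha using hz₁.1.2.2.2.2
  obtain ⟨z₂, hz₂, haz₂, hz₂a⟩ := exists_transversalNames_subset hα hinf hU hn.le hz₁.1
    ((hW.inter hW₂).mem_nhds ⟨hz₁D.2, hz₁W₂⟩) ha (hUo i₀) (ha i₀).2 subset_rfl
  obtain ⟨b, hb, hba⟩ : ∃ b ∈ psiMinus α z₂, b ∉ range a := by
    by_contra! hcon
    have h1 := ncard_le_ncard hcon (finite_range a)
    rw [hz₂.1.2.2.1, ← image_univ] at h1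
    have h2 := ncard_image_le (f := a) finite_univ
    rw [ncard_univ, Nat.card_eq_fintype_card] at h2
    omega
  obtain ⟨V, U', hVo, hVU, hVdisj, hVcov, hU'o, hU', hz₂U', hU'sub, hVne⟩ :=
    exists_split_transversalNames hUo hU hz₂.1 ⟨haz₂ ⟨i₀, rfl⟩, (ha i₀).2⟩
      ⟨hb, (hz₂a hb).resolve_left hba⟩ (fun h => hba ⟨i₀, h⟩)
  obtain ⟨ε₂, hε₂, hball₂⟩ := lebesgue_number_lemma_of_metric
    (hz₂.1.2.1.subset inter_subset_left).isCompact hVo hVcov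
  have hmono : ∀ z, 𝓝[transversalNames α n U ∩ W ∩ W₂] z ≤ 𝓝[transversalNames α n U ∩ W] z :=
    fun z => nhdsWithin_mono z inter_subset_left
  have hz₂D : z₂ ∈ transversalNames α n U ∩ W ∩ W₂ := ⟨⟨hz₂.1, hz₂.2.1⟩, hz₂.2.2⟩
  obtain ⟨η₃, hη₃, hev₃⟩ := hans₂.exists_ball hβ hK
    (fun z hz O hO hFO => hmono z (husc z hz.1 O hO hFO)) (fun z hz => hsol z hz.1) hz₂D
    (hcomp z₂ hz₂D.1) hε₂
  obtain ⟨W₃, hW₃, hz₂W₃, hW₃sub⟩ := mem_nhdsWithin.1 hev₃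
  obtain ⟨z₃, hz₃, hz₃small⟩ := hsmall (Option ι) U' (W ∩ W₂ ∩ W₃)
    (by rw [Fintype.card_option]) hU'o hU' ((hW.inter hW₂).inter hW₃)
    ⟨z₂, hz₂U', hz₂.2, hz₂W₃⟩ (fun z hz => ⟨hU'sub hz.1, hz.2.1.1⟩) η₃ hη₃
  have hz₃D : z₃ ∈ transversalNames α n U ∩ W ∩ W₂ :=
    ⟨⟨hU'sub hz₃.1, hz₃.2.1.1⟩, hz₃.2.1.2⟩
  obtain ⟨y₂, hy₂, W₄, hW₄, hz₃W₄, hans₄⟩ := hW₃sub ⟨hz₃.2.2, hz₃D⟩ (hFne z₃ hz₃D.1) hz₃small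
  obtain ⟨t, ht⟩ := hball₂ y₂ ⟨hy₂.1, hi₀ hy₂.2⟩
  choose a₃ ha₃ using hz₃D.1.1.2.2.2.2
  obtain ⟨c, hcA, hcV⟩ := hVne z₃ hz₃.1 (!t)
  obtain ⟨z₄, hz₄, -, hz₄c⟩ := exists_transversalNames_subset hα hinf hU hn.le hz₃D.1.1
    (((hW.inter hW₂).inter hW₄).mem_nhds ⟨⟨hz₃D.1.2, hz₃D.2⟩, hz₃W₄⟩)
    (a := Function.update a₃ i₀ c) (fun i => by
      by_cases hi : i = i₀
      · subst hi
        simpa using ⟨hcA, hVU _ hcV⟩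
      · simpa [hi] using ha₃ i)
    (hVo !t) (i₀ := i₀) (by simpa using hcV) (hVU !t)
  have hz₄D : z₄ ∈ transversalNames α n U ∩ W := ⟨hz₄.1, hz₄.2.1.1⟩
  obtain ⟨x, hx⟩ := hFne z₄ hz₄D
  obtain ⟨q, -, -, y, hy, -⟩ := hans₄ z₄ ⟨⟨hz₄D, hz₄.2.1.2⟩, hz₄.2.2⟩ x hx
  have hyV : y ∈ V t := ht hy.2
  rcases hz₄c hy.1 with ⟨i, rfl⟩ | hy'
  · by_cases hi : i = i₀
    · subst hi
      exact disjoint_left.1 (hVdisj t) hyV (by simpa using hcV)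
    · refine disjoint_left.1 (hU hi) (ha₃ i).2 ?_
      have := hVU t hyV
      simpa [hi] using this
  · exact disjoint_left.1 (hVdisj t) hyV hy'

end Splitting

section Dimension

open Set Filter Topology Metric

variable {X : Type*} [MetricSpace X]

/-- The affine subspace obtained by prescribing the coordinates in `I`. -/
def coordSlice {d : ℕ} (I : Finset (Fin d)) (c : Fin d → ℝ) : Set (Fin d → ℝ) :=
  {x | ∀ i ∈ I, x i = c i}

theorem isClosed_coordSlice {d : ℕ} (I : Finset (Fin d)) (c : Fin d → ℝ) :
    IsClosed (coordSlice I c) := by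
  simp only [coordSlice, ofPred_forall]
  exact isClosed_biInter fun i _ => isClosed_eq (continuous_apply i) continuous_const

theorem convex_coordSlice {d : ℕ} (I : Finset (Fin d)) (c : Fin d → ℝ) :
    Convex ℝ (coordSlice I c) := by
  intro x hx y hy a b _ _ hab i hi
  simp [hx i hi, hy i hi, ← add_mul, hab]

/-- Some family of at most `k + s` disjoint open sets, locally, forces the values of `M` to meet
a fixed coordinate slice of codimension `s`. -/
def HasSlice (α : ℕ → X) (n k : ℕ) {d : ℕ} (M : Baire → Set (Fin d → ℝ)) (D₀ : Set Baire)
    (s : ℕ) : Prop :=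
  ∃ (ι : Type) (_ : Fintype ι) (U : ι → Set X) (W : Set Baire),
    (∀ i, IsOpen (U i)) ∧ Pairwise (Function.onFun Disjoint U) ∧ IsOpen W ∧
    (transversalNames α n U ∩ W).Nonempty ∧ transversalNames α n U ∩ W ⊆ D₀ ∧
    Fintype.card ι ≤ k + s ∧ ∃ (I : Finset (Fin d)) (c : Fin d → ℝ), I.card = s ∧
      ∀ z ∈ transversalNames α n U ∩ W, (M z ∩ coordSlice I c).Nonempty

theorem HasSlice.le {α : ℕ → X} {n k d s : ℕ} {M : Baire → Set (Fin d → ℝ)} {D₀ : Set Baire}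
    (h : HasSlice α n k M D₀ s) : s ≤ d := by
  obtain ⟨ι, _, U, W, -, -, -, -, -, -, I, c, rfl, -⟩ := h
  simpa using I.card_le_univ

/-- Dimension bound: convex-valued upper semicontinuous maps into the `d`-cube do not allow to
continuously find points of `n`-element sets meeting `k` prescribed sets if `k + d < n`. -/
theorem le_of_convex_solutions {α : ℕ → X} (hα : DenseRange α)
    (hinf : ∀ O : Set X, IsOpen O → O.Nonempty → O.Infinite) {d : ℕ} {β : ℕ → (Fin d → ℝ)}
    (hβ : DenseRange β) {K : Baire → Baire} {dK : Set Baire} (hK : ContinuousOn K dK) {n : ℕ}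
    {ι : Type} [Fintype ι] {U : ι → Set X} (hUo : ∀ i, IsOpen (U i))
    (hU : Pairwise (Function.onFun Disjoint U)) {W : Set Baire} (hW : IsOpen W)
    (hne : (transversalNames α n U ∩ W).Nonempty)
    {M : Baire → Set (Fin d → ℝ)} (hMne : ∀ z ∈ transversalNames α n U ∩ W, (M z).Nonempty)
    (hcomp : ∀ z ∈ transversalNames α n U ∩ W, IsCompact (M z))
    (hconv : ∀ z ∈ transversalNames α n U ∩ W, Convex ℝ (M z))
    (hcube : ∀ z ∈ transversalNames α n U ∩ W, M z ⊆ unitCube d)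
    (husc : ∀ z ∈ transversalNames α n U ∩ W, ∀ O, IsOpen O → M z ⊆ O →
      ∀ᶠ z' in 𝓝[transversalNames α n U ∩ W] z, M z' ⊆ O)
    (hsol : ∀ z ∈ transversalNames α n U ∩ W, ∀ x ∈ M z, ∀ q, (pointRep β).R q x →
      pairB z q ∈ dK ∧ ∃ y ∈ psiMinus α z, (pointRep α).R (K (pairB z q)) y) :
    n ≤ Fintype.card ι + d := by
  classical
  by_contra! hn
  set D₀ := transversalNames α n U ∩ W with hD₀
  set k := Fintype.card ι with hk
  have hstart : HasSlice α n k M D₀ 0 :=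
    ⟨ι, inferInstance, U, W, hUo, hU, hW, hne, subset_rfl, hk.ge, ∅, 0, rfl, fun z hz => by
      simpa [coordSlice] using hMne z hz⟩
  obtain ⟨s, hs, hs'⟩ : ∃ s, HasSlice α n k M D₀ s ∧ ¬ HasSlice α n k M D₀ (s + 1) := by
    by_contra! hcon
    have : ∀ s, HasSlice α n k M D₀ s := fun s => Nat.rec hstart hcon s
    exact absurd (this (d + 1)).le (by omega)
  have hsd := hs.le
  obtain ⟨ι₁, _, U₁, W₁, hU₁o, hU₁, hW₁, hne₁, hsub₁, hcard₁, I, c, hI, hIc⟩ := hs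
  have huscE : ∀ D ⊆ D₀, ∀ z ∈ D, ∀ O, IsOpen O → M z ∩ coordSlice I c ⊆ O →
      ∀ᶠ z' in 𝓝[D] z, M z' ∩ coordSlice I c ⊆ O := by
    intro D hD z hz O hO hMO
    have hev := husc z (hD hz) _ (hO.union (isClosed_coordSlice I c).isOpen_compl) fun x hx => by
      by_cases hxc : x ∈ coordSlice I c
      · exact Or.inl (hMO ⟨hx, hxc⟩)
      · exact Or.inr hxc
    filter_upwards [nhdsWithin_mono z hD hev] with z' hz' x hx
    exact (hz' hx.1).resolve_right fun h => h hx.2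
  refine false_of_small_values hα hinf hβ hK hU₁o hU₁ hW₁ hne₁ (by omega)
    (F := fun z => M z ∩ coordSlice I c) hIc
    (fun z hz => (hcomp z (hsub₁ hz)).inter_right (isClosed_coordSlice I c))
    (huscE _ hsub₁) (fun z hz x hx => hsol z (hsub₁ hz) x hx.1) ?_
  intro κ _ U₂ W₂ hcard₂ hU₂o hU₂ hW₂ hne₂ hsub₂ η hη
  have hsub₂' := hsub₂.trans hsub₁
  rcases exists_small_value_or_slice hne₂ (F := fun z => M z ∩ coordSlice I c)
    (fun z hz => (hconv z (hsub₂' hz)).inter (convex_coordSlice I c))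
    (fun z hz => inter_subset_left.trans (hcube z (hsub₂' hz))) (huscE _ hsub₂') hη with
    h | ⟨z, hz, W₃, hW₃, hzW₃, i, r, ⟨x, hx, y, hy, hxy⟩, hslice⟩
  · exact h
  · have hiI : i ∉ I := fun hi => hxy ((hx.2 i hi).trans (hy.2 i hi).symm)
    refine absurd ⟨κ, inferInstance, U₂, W₂ ∩ W₃, hU₂o, hU₂, hW₂.inter hW₃,
      ⟨z, hz.1, hz.2, hzW₃⟩, fun z hz => hsub₂' ⟨hz.1, hz.2.1⟩, by omega, insert i I,
      Function.update c i r, by rw [Finset.card_insert_of_notMem hiI, hI], ?_⟩ hs'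
    intro z' hz'
    obtain ⟨w, hw, hwr⟩ := hslice z' ⟨⟨hz'.1, hz'.2.1⟩, hz'.2.2⟩
    refine ⟨w, hw.1, fun j hj => ?_⟩
    by_cases hji : j = i
    · subst hji
      simpa using hwr
    · simpa [hji] using hw.2 j ((Finset.mem_insert.1 hj).resolve_left hji)

end Dimension

section LowerBound

open Set Filter Topology Metric

theorem infinite_of_isOpen_Icc (O : Set ↥(Icc (0 : ℝ) 1)) (hO : IsOpen O) (hne : O.Nonempty) :
    O.Infinite := by
  obtain ⟨x, hx⟩ := hne
  have : ConnectedSpace ↥(Icc (0 : ℝ) 1) :=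
    Subtype.connectedSpace (isConnected_Icc zero_le_one)
  have : Nontrivial ↥(Icc (0 : ℝ) 1) :=
    ⟨⟨0, by simp⟩, ⟨1, by simp⟩, fun h => zero_ne_one (congrArg Subtype.val h)⟩
  have := ConnectedSpace.neBot_nhdsWithin_compl_of_nontrivial_of_t1space x
  exact infinite_of_mem_nhds x (hO.mem_nhds hx)

/-- The interior of the `i`-th of the `n` intervals in the definition of `boxClass`. -/
def openBox (n : ℕ) (i : Fin n) : Set ↥(Icc (0 : ℝ) 1) :=
  {x | 2 * (i : ℝ) / (2 * n) < (x : ℝ) ∧ (x : ℝ) < (2 * (i : ℝ) + 1) / (2 * n)}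

theorem isOpen_openBox (n : ℕ) (i : Fin n) : IsOpen (openBox n i) :=
  (isOpen_lt continuous_const continuous_subtype_val).inter
    (isOpen_lt continuous_subtype_val continuous_const)

theorem openBox_subset_box (n : ℕ) (i : Fin n) : openBox n i ⊆ box n i :=
  fun _ hx => ⟨hx.1.le, hx.2.le⟩

theorem openBox_nonempty (n : ℕ) (i : Fin n) : (openBox n i).Nonempty := by
  have hn : (0 : ℝ) < n := by
    have : 0 < n := i.pos
    positivity
  have hi : (i : ℝ) + 1 ≤ n := by exact_mod_cast i.2
  refine ⟨⟨(4 * i + 1) / (4 * n), by positivity, ?_⟩, ?_, ?_⟩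
  · rw [div_le_one (by positivity)]
    linarith
  · change 2 * (i : ℝ) / (2 * n) < (4 * i + 1) / (4 * n)
    rw [div_lt_div_iff₀ (by positivity) (by positivity)]
    nlinarith
  · change (4 * (i : ℝ) + 1) / (4 * n) < (2 * i + 1) / (2 * n)
    rw [div_lt_div_iff₀ (by positivity) (by positivity)]
    nlinarith

theorem openBox_pairwise_disjoint {n k : ℕ} (hkn : k ≤ n) :
    Pairwise (Function.onFun Disjoint fun i : Fin k => openBox n (i.castLE hkn)) :=
  fun _ _ hij => disjoint_left.2 fun _ hi hj => hij (Fin.castLE_injective hkn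
    (box_eq_of_mem (openBox_subset_box n _ hi) (openBox_subset_box n _ hj)))

theorem psiMinus_mem_boxClass {α : ℕ → ↥(Icc (0 : ℝ) 1)} {n k : ℕ} (hkn : k ≤ n) {z : Baire}
    (hz : z ∈ transversalNames α n fun i : Fin k => openBox n (i.castLE hkn)) :
    psiMinus α z ∈ boxClass n k := by
  refine ⟨hz.2.1, hz.2.2.1, ?_⟩
  have hsub : range (Fin.castLE hkn) ⊆ boxHits n (psiMinus α z) := by
    rintro _ ⟨i, rfl⟩
    obtain ⟨x, hx, hxi⟩ := hz.2.2.2.2 i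
    exact ⟨x, hx, openBox_subset_box n _ hxi⟩
  have h := ncard_le_ncard hsub
  rw [← image_univ, ncard_image_of_injective _ (Fin.castLE_injective hkn), ncard_univ,
    Nat.card_eq_fintype_card, Fintype.card_fin] at h
  exact h

theorem exists_realizes_choiceFn {Y : Type*} [MetricSpace Y] {β : ℕ → Y} (hβ : DenseRange β)
    (𝔄 : Set (Set Y)) {h q : Baire}
    (hq : psiMinus β h ∈ 𝔄 → (psiMinus β h).Nonempty → ∃ x ∈ psiMinus β h, (pointRep β).R q x) :
    ∃ G, Realizes (closedRep β) (pointRep β) (choiceFn 𝔄) G ∧ G h = q := by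
  classical
  have hex : ∀ p, ∃ q', (choiceFn 𝔄 (psiMinus β p)).Nonempty →
      ∃ y ∈ choiceFn 𝔄 (psiMinus β p), (pointRep β).R q' y := fun p => by
    by_cases hp : (choiceFn 𝔄 (psiMinus β p)).Nonempty
    · obtain ⟨y, hy⟩ := hp
      obtain ⟨q', hq'⟩ := pointRep_exists hβ y
      exact ⟨q', fun _ => ⟨y, hy, hq'⟩⟩
    · exact ⟨0, fun h => absurd h hp⟩
  choose G hG using hex
  refine ⟨Function.update G h q, ?_, by simp⟩
  rintro p x rfl hx
  by_cases hp : p = h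
  · subst hp
    obtain ⟨y, hyA, hy⟩ := hx
    obtain ⟨x, hx, hxq⟩ := hq hyA ⟨y, hy⟩
    exact ⟨x, ⟨hyA, hx⟩, by simpa using hxq⟩
  · simpa [hp] using hG p hx

theorem isCompact_unitCube (d : ℕ) : IsCompact (unitCube d) :=
  isCompact_univ_pi fun _ => isCompact_Icc

theorem convex_unitCube (d : ℕ) : Convex ℝ (unitCube d) :=
  convex_pi fun _ _ => convex_Icc 0 1

theorem closedConvexHull_inter_unitCube_subset {d : ℕ} (C : Set (Fin d → ℝ)) :
    closure (convexHull ℝ (C ∩ unitCube d)) ⊆ unitCube d :=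
  closure_minimal (convexHull_min inter_subset_right (convex_unitCube d))
    (isCompact_unitCube d).isClosed

/-- The closed convex hull of the part of a closed set in the unit cube depends upper
semicontinuously on negative names. -/
theorem eventually_closedConvexHull_subset {d : ℕ} (β : ℕ → (Fin d → ℝ)) {h : Baire}
    {O : Set (Fin d → ℝ)} (hO : IsOpen O)
    (hsub : closure (convexHull ℝ (psiMinus β h ∩ unitCube d)) ⊆ O) :
    ∀ᶠ h' in 𝓝 h, closure (convexHull ℝ (psiMinus β h' ∩ unitCube d)) ⊆ O := by
  have hcomp : IsCompact (closure (convexHull ℝ (psiMinus β h ∩ unitCube d))) :=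
    (isCompact_unitCube d).of_isClosed_subset isClosed_closure
      (closedConvexHull_inter_unitCube_subset _)
  obtain ⟨δ, hδ, hδO⟩ := hcomp.exists_cthickening_subset_open hO hsub
  have hthick : unitCube d ∩ psiMinus β h ⊆
      thickening δ (closure (convexHull ℝ (psiMinus β h ∩ unitCube d))) := fun x hx =>
    self_subset_thickening hδ _ (subset_closure (subset_convexHull ℝ _ ⟨hx.2, hx.1⟩))
  filter_upwards [eventually_inter_psiMinus_subset β (isCompact_unitCube d) isOpen_thickening
    hthick] with h' hh'
  rw [inter_comm] at hh'
  exact (closure_mono (convexHull_min hh' ((convex_convexHull ℝ _).closure.thickening δ))).trans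
    ((closure_thickening_subset_cthickening δ _).trans hδO)

/-- If choice from `n`-element sets meeting `k` boxes reduces to convex choice in dimension `d`,
then `n ≤ k + d`. -/
theorem le_of_wRed_boxClass_convexClass {n k d : ℕ} (hk : 1 ≤ k) (hkn : k ≤ n)
    {α : ℕ → ↥(Icc (0 : ℝ) 1)} (hα : DenseRange α) {β : ℕ → (Fin d → ℝ)} (hβ : DenseRange β)
    (hred : WRed (closedRep α) (pointRep α) (closedRep β) (pointRep β)
      (choiceFn (boxClass n k)) (choiceFn (convexClass d))) : n ≤ k + d := by
  obtain ⟨H, K, dH, dK, hH, hK, hHK⟩ := hred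
  let U : Fin k → Set ↥(Icc (0 : ℝ) 1) := fun i => openBox n (i.castLE hkn)
  set D := transversalNames α n U
  have : Nonempty (Fin k) := ⟨⟨0, hk⟩⟩
  have hUo : ∀ i, IsOpen (U i) := fun i => isOpen_openBox n _
  have hU := openBox_pairwise_disjoint hkn
  have hDne : D.Nonempty := transversalNames_nonempty hα infinite_of_isOpen_Icc hUo
    (fun i => openBox_nonempty n _) hU (by simpa using hkn)
  have hkey : ∀ z ∈ D, ∀ q, (psiMinus β (H z) ∈ convexClass d →
      ∃ x ∈ psiMinus β (H z), (pointRep β).R q x) →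
      z ∈ dH ∧ pairB z q ∈ dK ∧ ∃ y ∈ psiMinus α z, (pointRep α).R (K (pairB z q)) y := by
    intro z hz q hq
    obtain ⟨G, hG, rfl⟩ := exists_realizes_choiceFn hβ (convexClass d) fun h _ => hq h
    have hbox := psiMinus_mem_boxClass hkn hz
    obtain ⟨x, hx, -⟩ := hz.2.2.2.2 ⟨0, hk⟩
    obtain ⟨h1, h2, y, hy, h3⟩ := hHK G hG z _ rfl ⟨x, hbox, hx⟩
    exact ⟨h1, h2, y, hy.2, h3⟩
  have hHD : ContinuousOn H D := hH.mono fun z hz => by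
    by_cases hC : (psiMinus β (H z)).Nonempty
    · obtain ⟨q, hq⟩ := pointRep_exists hβ hC.some
      exact (hkey z hz q fun _ => ⟨_, hC.some_mem, hq⟩).1
    · exact (hkey z hz 0 fun h => absurd h.1 hC).1
  by_cases hcase : ∃ z ∈ D, unitCube d ∩ psiMinus β (H z) ⊆ ∅
  · obtain ⟨z, hz, hempty⟩ := hcase
    obtain ⟨W, hW, hzW, hWD⟩ := mem_nhdsWithin.1 ((hHD z hz).eventually
      (eventually_inter_psiMinus_subset β (isCompact_unitCube d) isOpen_empty hempty))
    simpa using le_of_convex_solutions hα infinite_of_isOpen_Icc hβ hK hUo hU hW ⟨z, hz, hzW⟩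
      (M := fun _ => {0}) (fun _ _ => singleton_nonempty _) (fun _ _ => isCompact_singleton)
      (fun _ _ => convex_singleton _) (fun _ _ => by simp [unitCube, Pi.le_def])
      (fun _ _ _ _ h => Eventually.of_forall fun _ => h)
      (fun z' hz' x _ q _ => (hkey z' hz'.1 q fun hC => by
        obtain ⟨y, hy⟩ := hC.1
        exact (hWD ⟨hz'.2, hz'.1⟩ ⟨hC.2.2.2 hy, hy⟩).elim).2)
  · push Not at hcase
    simpa using le_of_convex_solutions hα infinite_of_isOpen_Icc hβ hK hUo hU isOpen_univ
      (by simpa using hDne)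
      (M := fun z => closure (convexHull ℝ (psiMinus β (H z) ∩ unitCube d)))
      (fun z hz => by
        obtain ⟨x, hx⟩ := nonempty_iff_ne_empty.2 fun h => hcase z hz.1 h.subset
        exact ⟨x, subset_closure (subset_convexHull ℝ _ ⟨hx.2, hx.1⟩)⟩)
      (fun z _ => (isCompact_unitCube d).of_isClosed_subset isClosed_closure
        (closedConvexHull_inter_unitCube_subset _))
      (fun z _ => (convex_convexHull ℝ _).closure)
      (fun z _ => closedConvexHull_inter_unitCube_subset _)
      (fun z hz O hO hMO => by
        rw [inter_univ]
        exact (hHD z hz.1).eventually (eventually_closedConvexHull_subset β hO hMO))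
      (fun z hz x hx q hq => (hkey z hz.1 q fun hC => by
        refine ⟨x, ?_, hq⟩
        rwa [inter_eq_left.2 hC.2.2.2, hC.2.2.1.convexHull_eq, hC.2.1.closure_eq] at hx).2)

end LowerBound

/-- For n ≥ k+1 ≥ 2 and m ≥ 1: if C_{#=n▷k} ≤_W XC_{m+1} then
C_{#=n▷(k+1)} ≤_W XC_m. -/
theorem stmt17 (n k m : ℕ) (h1 : k + 1 ≤ n) (h2 : 1 ≤ k) (h3 : 1 ≤ m)
    (α : ℕ → ↥(Set.Icc (0:ℝ) 1)) (hα : DenseRange α)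
    (β : ℕ → (Fin (m + 1) → ℝ)) (hβ : DenseRange β)
    (β' : ℕ → (Fin m → ℝ)) (hβ' : DenseRange β')
    (hred : WRed (closedRep α) (pointRep α) (closedRep β) (pointRep β)
      (choiceFn (boxClass n k)) (choiceFn (convexClass (m + 1)))) :
    WRed (closedRep α) (pointRep α) (closedRep β') (pointRep β')
      (choiceFn (boxClass n (k + 1))) (choiceFn (convexClass m)) := by
  refine wRed_boxClass_convexClass h3 ?_ hα hβ'
  have := le_of_wRed_boxClass_convexClass h2 (by omega) hα hβ hred
  omega
end

section
/- Let f : [0,1] → ℝ be continuous with f(0) ≠ 0 and f(1) ≠ 0. Suppose the set E of local extremum points of f is finite, with |E| = k. Then the zero set {x ∈ [0,1] | f(x) = 0} is finite and contains at most k + 1 points. -/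
/-- **Rolle's theorem, counting form**: the number of points at which a continuous function takes a
given value exceeds the number of its local extrema by at most one. -/
theorem finite_fiber_and_ncard_le_of_finite_localExtr {X : Type*}
    [ConditionallyCompleteLinearOrder X] [DenselyOrdered X] [TopologicalSpace X] [OrderTopology X]
    {f : X → ℝ} (hf : Continuous f) (hE : {x | IsLocalExtr f x}.Finite) (c : ℝ) :
    {x | f x = c}.Finite ∧ {x | f x = c}.ncard ≤ {x | IsLocalExtr f x}.ncard + 1 := by
  have card_le (s : Finset X) (hs : ∀ x ∈ s, f x = c) :
      s.card ≤ {x | IsLocalExtr f x}.ncard + 1 := by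
    rw [Set.ncard_eq_toFinset_card _ hE]
    refine Finset.card_le_of_interleaved fun x hx y hy hxy _ => ?_
    obtain ⟨z, hz, hfz⟩ :=
      exists_isLocalExtr_Ioo hxy hf.continuousOn ((hs x hx).trans (hs y hy).symm)
    exact ⟨z, by simpa using hfz, hz.1, hz.2⟩
  have hfin : {x | f x = c}.Finite := by
    by_contra hinf
    obtain ⟨s, hs, hcard⟩ :=
      Set.Infinite.exists_subset_card_eq hinf ({x | IsLocalExtr f x}.ncard + 2)
    have := card_le s hs
    lia
  refine ⟨hfin, ?_⟩
  rw [Set.ncard_eq_toFinset_card _ hfin]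
  exact card_le _ fun x hx => by simpa using hx

/-- If f : [0,1] → ℝ is continuous, f(0) ≠ 0 ≠ f(1), and the set of local
extremum points of f is finite with k elements, then the zero set of f is finite with at
most k + 1 points. -/
theorem stmt19 (f : ↥(Set.Icc (0:ℝ) 1) → ℝ) (hf : Continuous f)
    (h0 : f ⟨0, by norm_num⟩ ≠ 0) (h1 : f ⟨1, by norm_num⟩ ≠ 0) (k : ℕ)
    (hE : {x : ↥(Set.Icc (0:ℝ) 1) | IsLocalMax f x ∨ IsLocalMin f x}.Finite)
    (hcard : {x : ↥(Set.Icc (0:ℝ) 1) | IsLocalMax f x ∨ IsLocalMin f x}.ncard = k) :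
    {x : ↥(Set.Icc (0:ℝ) 1) | f x = 0}.Finite
    ∧ {x : ↥(Set.Icc (0:ℝ) 1) | f x = 0}.ncard ≤ k + 1 := by
  have hext : {x : ↥(Set.Icc (0:ℝ) 1) | IsLocalMax f x ∨ IsLocalMin f x} = {x | IsLocalExtr f x} :=
    Set.ext fun _ => or_comm
  rw [hext] at hE hcard
  rw [← hcard]
  exact finite_fiber_and_ncard_le_of_finite_localExtr hf hE 0
end
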